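/- arXiv:0812.3097 — 3 statements merged into one kernel-verified Lean document; each statement's English description precedes it below -/
import Mathlib

section
/- Let G be a finite connected bipartite graph. Then the binomial arithmetical rank of the toric ideal I_G equals its minimal number of generators: bar(I_G) = μ(I_G). -/
open MvPolynomial

noncomputable section

/-- The exponent of the variable `t j` in the image of `x i`: it is `1` if the vertex `j`
is an endpoint of the edge `e i`, and `0` otherwise (incidence vector of the edge `e i`). -/
def incid {n m : ℕ} (e : Fin m → Sym2 (Fin n)) (i : Fin m) (j : Fin n) : ℕ :=
  if j ∈ e i then 1 else 0

/-- The `K`-algebra homomorphism `K[x_1,…,x_m] → K[t_1,…,t_n]` sending `x i` to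
`t_j t_k`, where `e i = {v_j, v_k}`. -/
def toricMap (K : Type*) [CommRing K] {n m : ℕ} (e : Fin m → Sym2 (Fin n)) :
    MvPolynomial (Fin m) K →ₐ[K] MvPolynomial (Fin n) K :=
  aeval fun i => ∏ j, X j ^ incid e i j

/-- The toric ideal `I_G` of the graph with edges `e`. -/
def toricIdeal (K : Type*) [CommRing K] {n m : ℕ} (e : Fin m → Sym2 (Fin n)) :
    Ideal (MvPolynomial (Fin m) K) :=
  RingHom.ker (toricMap K e)

/-- A binomial is a difference of two monomials. -/
def IsBinomial {K : Type*} [CommRing K] {σ : Type*} (p : MvPolynomial σ K) : Prop :=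
  ∃ u v : σ →₀ ℕ, p = monomial u 1 - monomial v 1

/-- The minimal number of generators of an ideal. -/
def mu {R : Type*} [CommRing R] (I : Ideal R) : ℕ :=
  sInf {s | ∃ F : Fin s → R, Ideal.span (Set.range F) = I}

/-- The binomial arithmetical rank: the least `s` such that there are `s` binomials in `I`
generating `I` up to radical. -/
def bar {K : Type*} [CommRing K] {σ : Type*} (I : Ideal (MvPolynomial σ K)) : ℕ :=
  sInf {s | ∃ F : Fin s → MvPolynomial σ K, (∀ i, IsBinomial (F i)) ∧ (∀ i, F i ∈ I) ∧
    (Ideal.span (Set.range F)).radical = I}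

/-- The edge family `e` is bipartite: the vertices split into a set `A` and its complement
such that every edge joins a vertex of `A` with a vertex outside `A`. -/
def IsBipartite {n m : ℕ} (e : Fin m → Sym2 (Fin n)) : Prop :=
  ∃ A : Set (Fin n), ∀ i : Fin m, ∀ v w : Fin n, e i = s(v, w) →
    ((v ∈ A ∧ w ∉ A) ∨ (v ∉ A ∧ w ∈ A))

section Comb
open Finset

/-- Two exponent vectors lie in the same fiber. -/
def Eqv {E V : Type*} (α β : E → V) (u v : E →₀ ℕ) : Prop :=
  u.mapDomain α = v.mapDomain α ∧ u.mapDomain β = v.mapDomain β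

/-- `i` is an edge of the subgraph induced on the vertices of `u`. -/
def Inside {E V : Type*} (α β : E → V) (u : E →₀ ℕ) (i : E) : Prop :=
  (∃ j, u j ≠ 0 ∧ α j = α i) ∧ (∃ j, u j ≠ 0 ∧ β j = β i)

/-- The pair `(u, v)` spans the lattice of the subgraph induced on its vertices. -/
def Good {E V : Type*} (α β : E → V) (u v : E →₀ ℕ) : Prop :=
  u ≠ v ∧ (∀ i, u i = 0 ∨ v i = 0) ∧ Eqv α β u v ∧
  ∀ a b, Eqv α β a b → (∀ i, a i ≠ 0 ∨ b i ≠ 0 → Inside α β u i) →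
    ∃ k : ℤ, ∀ i, (a i : ℤ) - b i = k * (u i - v i)

def ind {E : Type*} (O : Finset E) : E →₀ ℕ := ∑ i ∈ O, Finsupp.single i 1

theorem ind_apply {E : Type*} [DecidableEq E] (O : Finset E) (i : E) :
    ind O i = if i ∈ O then 1 else 0 := by
  simp [ind, Finsupp.finsetSum_apply, Finsupp.single_apply]

theorem mapDomain_ind {E V : Type*} (α : E → V) (O : Finset E) :
    (ind O).mapDomain α = ∑ i ∈ O, Finsupp.single (α i) 1 := by
  simp [ind, Finsupp.mapDomain_finsetSum, Finsupp.mapDomain_single]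

theorem Eqv.symm {E V : Type*} {α β : E → V} {u v : E →₀ ℕ} (h : Eqv α β u v) :
    Eqv α β v u := ⟨h.1.symm, h.2.symm⟩

theorem Eqv.trans {E V : Type*} {α β : E → V} {u v w : E →₀ ℕ} (h : Eqv α β u v)
    (h' : Eqv α β v w) : Eqv α β u w := ⟨h.1.trans h'.1, h.2.trans h'.2⟩

theorem Eqv.add_left {E V : Type*} {α β : E → V} {u v : E →₀ ℕ} (r : E →₀ ℕ)
    (h : Eqv α β u v) : Eqv α β (r + u) (r + v) := by
  simp [Eqv, Finsupp.mapDomain_add, h.1, h.2]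

theorem Eqv.of_add_left {E V : Type*} {α β : E → V} {u v : E →₀ ℕ} {r : E →₀ ℕ}
    (h : Eqv α β (r + u) (r + v)) : Eqv α β u v := by
  simpa [Eqv, Finsupp.mapDomain_add] using h

theorem exists_single_add {E : Type*} {u : E →₀ ℕ} {i : E} (h : u i ≠ 0) :
    ∃ r, u = Finsupp.single i 1 + r := by
  classical
  refine ⟨u - Finsupp.single i 1, ?_⟩
  ext j
  simp only [Finsupp.add_apply, Finsupp.tsub_apply, Finsupp.single_apply]
  split_ifs with hj
  · subst hj; omega
  · omega

theorem exists_of_mapDomain {E V : Type*} {α : E → V} {u v : E →₀ ℕ}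
    (h : u.mapDomain α = v.mapDomain α) {i : E} (hi : u i ≠ 0) : ∃ j, v j ≠ 0 ∧ α j = α i := by
  classical
  obtain ⟨r, rfl⟩ := exists_single_add hi
  have h1 : α i ∈ (v.mapDomain α).support := by
    rw [← h, Finsupp.mapDomain_add, Finsupp.mapDomain_single]
    simp
  have := Finsupp.mapDomain_support h1
  simpa using this

theorem Eqv.inside {E V : Type*} {α β : E → V} {u v : E →₀ ℕ} (h : Eqv α β u v) {i : E}
    (hi : Inside α β u i) : Inside α β v i := by
  obtain ⟨⟨j, hj, hj'⟩, k, hk, hk'⟩ := hi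
  obtain ⟨j1, h1, h1'⟩ := exists_of_mapDomain h.1 hj
  obtain ⟨k1, h2, h2'⟩ := exists_of_mapDomain h.2 hk
  exact ⟨⟨j1, h1, h1'.trans hj'⟩, k1, h2, h2'.trans hk'⟩

theorem inside_self {E V : Type*} {α β : E → V} {u : E →₀ ℕ} {i : E} (h : u i ≠ 0) :
    Inside α β u i := ⟨⟨i, h, rfl⟩, i, h, rfl⟩

theorem exists_invariant {E : Type*} [DecidableEq E] (F : E → E) (s : Finset E) :
    s.Nonempty → s.image F ⊆ s → ∃ O ⊆ s, O.Nonempty ∧ O.image F = O := by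
  induction s using Finset.strongInduction with
  | H s ih =>
    intro hs hF
    by_cases h : s.image F = s
    · exact ⟨s, subset_rfl, hs, h⟩
    · obtain ⟨O, h1, h2, h3⟩ := ih (s.image F) (hF.ssubset_of_ne h) (hs.image F)
        (Finset.image_subset_image hF)
      exact ⟨O, h1.trans hF, h2, h3⟩

theorem exists_orbit {E V : Type*} [DecidableEq E] (α β : E → V) (q p : E → E) (s : Finset E)
    (hs : s.Nonempty) (hF : ∀ i ∈ s, p (q i) ∈ s) (hq : ∀ i ∈ s, β (q i) = β i)
    (hp : ∀ i ∈ s, α (p (q i)) = α (q i)) :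
    ∃ O ⊆ s, O.Nonempty ∧ O.image (fun i => p (q i)) = O ∧ Set.InjOn q O ∧
      Eqv α β (ind O) (ind (O.image q)) := by
  obtain ⟨O, h1, h2, h3⟩ := exists_invariant (fun i => p (q i)) s hs (by
    intro x hx
    obtain ⟨i, hi, rfl⟩ := Finset.mem_image.1 hx
    exact hF i hi)
  have hinj : Set.InjOn (fun i => p (q i)) O := by
    rw [← Finset.card_image_iff, h3]
  have hqi : Set.InjOn q O := fun x hx y hy h => hinj hx hy (by simp [h])
  refine ⟨O, h1, h2, h3, hqi, ?_, ?_⟩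
  · rw [mapDomain_ind, mapDomain_ind, Finset.sum_image hqi]
    conv_lhs => rw [← h3]
    rw [Finset.sum_image hinj]
    exact Finset.sum_congr rfl fun i hi => by rw [hp i (h1 hi)]
  · rw [mapDomain_ind, mapDomain_ind, Finset.sum_image hqi]
    exact Finset.sum_congr rfl fun i hi => by rw [hq i (h1 hi)]

theorem ind_le {E : Type*} [DecidableEq E] {O : Finset E} {u : E →₀ ℕ} (h : ∀ i ∈ O, u i ≠ 0) :
    ∃ r, u = r + ind O := by
  refine ⟨u - ind O, ?_⟩
  ext j
  simp only [Finsupp.add_apply, Finsupp.tsub_apply, ind_apply]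
  split_ifs with hj
  · have := h j hj; omega
  · omega

/-- No element of the fiber shares a variable with both `u` and `v`. -/
def FibSep {E V : Type*} (α β : E → V) (u v : E →₀ ℕ) : Prop :=
  ∀ w, Eqv α β u w → (∃ i, w i ≠ 0 ∧ u i ≠ 0) → (∃ i, w i ≠ 0 ∧ v i ≠ 0) → False

theorem eq_ind_of_sep {E V : Type*} [DecidableEq E] {α β : E → V} {u v : E →₀ ℕ}
    (hsep : FibSep α β u v) {O O' : Finset E} (hO' : O'.Nonempty)
    (h1 : ∀ i ∈ O, u i ≠ 0) (h2 : ∀ i ∈ O', v i ≠ 0) (h : Eqv α β (ind O) (ind O')) :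
    u = ind O := by
  obtain ⟨r, rfl⟩ := ind_le h1
  by_contra hr
  have hr : r ≠ 0 := by rintro rfl; simp at hr
  obtain ⟨i, hi⟩ := Finsupp.ne_iff.1 hr
  obtain ⟨j, hj⟩ := hO'
  have hi' : r i ≠ 0 := by simpa using hi
  refine hsep (r + ind O') (h.add_left r) ⟨i, ?_, ?_⟩ ⟨j, ?_, h2 j hj⟩
  · simp [hi']
  · simp [hi']
  · simp [ind_apply, hj]

theorem mapDomain_two {E V : Type*} {γ : E → V} {a : E →₀ ℕ} {x y : E} (hxy : x ≠ y)
    (h : γ x = γ y) (hz : ∀ z, a z ≠ 0 → γ z = γ x → z = x ∨ z = y) :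
    (a.mapDomain γ) (γ x) = a x + a y := by
  classical
  have h1 : a = Finsupp.single x (a x) + (Finsupp.single y (a y) + (a.erase x).erase y) := by
    have e2 := Finsupp.single_add_erase y (a.erase x)
    rw [Finsupp.erase_ne hxy.symm] at e2
    rw [e2, Finsupp.single_add_erase]
  have h2 : (((a.erase x).erase y).mapDomain γ) (γ x) = 0 := by
    by_contra hc
    have := Finsupp.mapDomain_support (Finsupp.mem_support_iff.2 hc)
    obtain ⟨z, hz1, hz2⟩ := Finset.mem_image.1 this
    simp only [Finsupp.support_erase, Finset.mem_erase, Finsupp.mem_support_iff] at hz1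
    rcases hz z hz1.2.2 hz2 with h | h
    · exact hz1.2.1 h
    · exact hz1.1 h
  conv_lhs => rw [h1]
  rw [Finsupp.mapDomain_add, Finsupp.mapDomain_add, Finsupp.mapDomain_single,
    Finsupp.mapDomain_single, Finsupp.add_apply, Finsupp.add_apply, h2, ← h]
  simp

theorem good_of_sep {E V : Type*} {α β : E → V}
    (hab : ∀ i j, α i = α j → β i = β j → i = j) {u v : E →₀ ℕ}
    (huv : Eqv α β u v) (hne : u ≠ v) (hsep : FibSep α β u v) : Good α β u v := by
  classical
  have hsep' : FibSep α β v u := fun w h1 h2 h3 => hsep w (huv.trans h1) h3 h2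
  have hdisj : ∀ i, u i = 0 ∨ v i = 0 := by
    intro i
    by_contra! h
    exact hsep u ⟨rfl, rfl⟩ ⟨i, h.1, h.1⟩ ⟨i, h.1, h.2⟩
  have hu0 : ∃ i, u i ≠ 0 := by
    by_contra! h
    apply hne
    ext i
    by_contra hi
    obtain ⟨j, hj, _⟩ := exists_of_mapDomain huv.symm.1 (i := i) (by rw [h i] at hi; exact fun h => hi h.symm)
    exact hj (h j)
  -- the choice functions
  have hQ : ∀ b : V, ∃ j : E, (∃ i, u i ≠ 0 ∧ β i = b) → v j ≠ 0 ∧ β j = b := by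
    intro b
    by_cases h : ∃ i, u i ≠ 0 ∧ β i = b
    · obtain ⟨i, hi, rfl⟩ := h
      obtain ⟨j, hj⟩ := exists_of_mapDomain huv.2 hi
      exact ⟨j, fun _ => hj⟩
    · exact ⟨hu0.choose, fun h' => absurd h' h⟩
  have hP : ∀ a : V, ∃ j : E, (∃ i, v i ≠ 0 ∧ α i = a) → u j ≠ 0 ∧ α j = a := by
    intro a
    by_cases h : ∃ i, v i ≠ 0 ∧ α i = a
    · obtain ⟨i, hi, rfl⟩ := h
      obtain ⟨j, hj⟩ := exists_of_mapDomain huv.symm.1 hi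
      exact ⟨j, fun _ => hj⟩
    · exact ⟨hu0.choose, fun h' => absurd h' h⟩
  choose Q hQ using hQ
  choose P hP using hP
  set q : E → E := fun i => Q (β i) with hq
  set p : E → E := fun i => P (α i) with hp
  have hqv : ∀ i, u i ≠ 0 → v (q i) ≠ 0 ∧ β (q i) = β i := fun i hi => hQ _ ⟨i, hi, rfl⟩
  have hpu : ∀ i, v i ≠ 0 → u (p i) ≠ 0 ∧ α (p i) = α i := fun i hi => hP _ ⟨i, hi, rfl⟩
  -- every invariant subset is everything
  have key : ∀ s : Finset E, s.Nonempty → (∀ i ∈ s, u i ≠ 0) → (∀ i ∈ s, p (q i) ∈ s) →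
      ∃ O ⊆ s, O.image (fun i => p (q i)) = O ∧ Set.InjOn q O ∧ u = ind O ∧
        v = ind (O.image q) := by
    intro s hs hsu hsF
    obtain ⟨O, h1, h2, h3, h4, h5⟩ := exists_orbit α β q p s hs hsF
      (fun i hi => (hqv i (hsu i hi)).2) (fun i hi => (hpu _ (hqv i (hsu i hi)).1).2)
    have a1 : ∀ i ∈ O, u i ≠ 0 := fun i hi => hsu i (h1 hi)
    have a2 : ∀ i ∈ O.image q, v i ≠ 0 := by
      intro x hx
      obtain ⟨i, hi, rfl⟩ := Finset.mem_image.1 hx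
      exact (hqv i (a1 i hi)).1
    exact ⟨O, h1, h3, h4, eq_ind_of_sep hsep (h2.image q) a1 a2 h5,
      eq_ind_of_sep hsep' h2 a2 a1 h5.symm⟩
  obtain ⟨O, hO, hOF, hOq, huO, hvO⟩ := key u.support
    (by obtain ⟨i, hi⟩ := hu0; exact ⟨i, by simpa using hi⟩) (by simp)
    (by intro i hi; simpa using (hpu _ (hqv i (by simpa using hi)).1).1)
  have memO : ∀ i, u i ≠ 0 ↔ i ∈ O := by
    intro i; rw [huO, ind_apply]; simp
  have memO' : ∀ i, v i ≠ 0 ↔ i ∈ O.image q := by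
    intro i; rw [hvO, ind_apply]; simp
  have memF : ∀ i ∈ O, p (q i) ∈ O := by
    intro i hi
    exact (memO _).1 (hpu _ (hqv i ((memO i).2 hi)).1).1
  have hβu : ∀ i ∈ O, ∀ j ∈ O, β i = β j → i = j := by
    intro i hi j hj h
    exact hOq hi hj (by simp [hq, h])
  have hαv : ∀ i ∈ O, ∀ j ∈ O, α (q i) = α (q j) → q i = q j := by
    intro i hi j hj h
    have hinj : Set.InjOn (fun i => p (q i)) O := by
      rw [← Finset.card_image_iff, hOF]
    rw [hinj hi hj (by simp [hp, h])]
  have hαu : ∀ i ∈ O, ∀ j ∈ O, α i = α j → i = j := by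
    intro i hi j hj h
    rw [← hOF] at hi hj
    obtain ⟨i', hi', rfl⟩ := Finset.mem_image.1 hi
    obtain ⟨j', hj', rfl⟩ := Finset.mem_image.1 hj
    rw [(hpu _ (hqv _ ((memO _).2 hi')).1).2, (hpu _ (hqv _ ((memO _).2 hj')).1).2] at h
    simp [hp, h]
  -- there are no chords
  have chord : ∀ e0, Inside α β u e0 → u e0 ≠ 0 ∨ v e0 ≠ 0 := by
    intro e0 hin
    by_contra! hcon
    obtain ⟨hc1, hc2⟩ := hcon
    obtain ⟨i0, hi0, hi0'⟩ := hin.1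
    obtain ⟨k0, hk0, hk0'⟩ := hin.2
    set p' : E → E := fun j => if α j = α e0 then e0 else p j with hp'
    have hqs : ∀ i ∈ insert e0 O, v (q i) ≠ 0 ∧ β (q i) = β i := by
      intro i hi
      rcases Finset.mem_insert.1 hi with rfl | hi
      · exact hQ _ ⟨k0, hk0, hk0'⟩
      · exact hqv i ((memO i).2 hi)
    obtain ⟨C, h1, h2, h3, h4, h5⟩ := exists_orbit α β q p' (insert e0 O) (by simp)
      (by
        intro i hi
        by_cases h : α (q i) = α e0
        · simp [hp', h]
        · simp only [hp', h, if_false]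
          exact Finset.mem_insert_of_mem ((memO _).1 (hpu _ (hqs i hi).1).1))
      (fun i hi => (hqs i hi).2)
      (by
        intro i hi
        by_cases h : α (q i) = α e0
        · simp [hp', h]
        · simp only [hp', h, if_false]
          exact (hpu _ (hqs i hi).1).2)
    have hCv : ∀ i ∈ C.image q, v i ≠ 0 := by
      intro x hx
      obtain ⟨i, hi, rfl⟩ := Finset.mem_image.1 hx
      exact (hqs i (h1 hi)).1
    have hCu : ∀ i ∈ C, i ≠ e0 → u i ≠ 0 := by
      intro i hi hne
      exact (memO i).2 ((Finset.mem_insert.1 (h1 hi)).resolve_left hne)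
    by_cases he : e0 ∈ C
    · -- w = v - 1_{q C} + 1_C
      obtain ⟨r, hr⟩ := ind_le hCv
      have hw : Eqv α β u (r + ind C) := by
        refine huv.trans ?_
        conv => enter [3]; rw [hr]
        exact h5.symm.add_left r
      have hshare : ∃ i, (r + ind C) i ≠ 0 ∧ u i ≠ 0 := by
        by_contra! hno
        have hC1 : C = {e0} := by
          refine Finset.eq_singleton_iff_unique_mem.2 ⟨he, fun x hx => ?_⟩
          by_contra hxe
          exact hCu x hx hxe (hno x (by simp [ind_apply, hx]))
        rw [hC1] at h5
        have h6 : Eqv α β (ind {e0}) (ind {q e0}) := by simpa using h5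
        have h7 := h6.1
        rw [mapDomain_ind, mapDomain_ind] at h7
        simp only [Finset.sum_singleton] at h7
        have h8 := Finsupp.single_left_injective (one_ne_zero) h7
        have h9 := hab e0 (q e0) h8 (hqs e0 (by simp)).2.symm
        have := (hqs e0 (by simp)).1
        rw [← h9] at this
        exact this hc2
      have hr0 : r = 0 := by
        by_contra hr0
        obtain ⟨i, hi⟩ := Finsupp.ne_iff.1 hr0
        have hi' : r i ≠ 0 := by simpa using hi
        refine hsep _ hw hshare ⟨i, by simp [hi'], ?_⟩
        rw [hr]; simp [hi']
      have hi0O : i0 ∈ O := (memO _).1 hi0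
      have hne0 : i0 ≠ e0 := by rintro rfl; exact hi0 hc1
      have hw' : Eqv α β u (ind C) := by simpa [hr0] using hw
      -- α-degree at α e0 of u is one
      have hdeg : (u.mapDomain α) (α e0) = 1 := by
        rw [huO, mapDomain_ind, Finsupp.finsetSum_apply, Finset.sum_eq_single i0]
        · simp [hi0']
        · intro b hb hbi
          rw [Finsupp.single_apply, if_neg]
          intro hba
          exact hbi (hαu b hb i0 hi0O (hba.trans hi0'.symm))
        · exact fun h => absurd hi0O h
      have hi0C : i0 ∉ C := by
        intro hmem
        rw [hw'.1, mapDomain_ind, Finsupp.finsetSum_apply] at hdeg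
        have : ∑ i ∈ ({e0, i0} : Finset E), (Finsupp.single (α i) 1 : V →₀ ℕ) (α e0) ≤
            ∑ i ∈ C, (Finsupp.single (α i) 1 : V →₀ ℕ) (α e0) :=
          Finset.sum_le_sum_of_subset (by
            intro x hx
            rcases Finset.mem_insert.1 hx with rfl | hx
            · exact he
            · rw [Finset.mem_singleton.1 hx]; exact hmem)
        rw [hdeg, Finset.sum_pair hne0.symm, hi0'] at this
        simp at this
      have hcard : C.card = O.card := by
        have e1 : C.card = (C.image q).card := (Finset.card_image_iff.2 h4).symm
        have e2 : O.card = (O.image q).card := (Finset.card_image_iff.2 hOq).symm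
        have e3 : C.image q = O.image q := by
          ext x
          rw [← memO', hr, hr0, zero_add, ind_apply]
          simp
        rw [e1, e2, e3]
      have hsub : C.erase e0 = O.erase i0 := by
        apply Finset.eq_of_subset_of_card_le
        · intro x hx
          obtain ⟨hx1, hx2⟩ := Finset.mem_erase.1 hx
          refine Finset.mem_erase.2 ⟨?_, (memO _).1 (hCu x hx2 hx1)⟩
          rintro rfl; exact hi0C hx2
        · rw [Finset.card_erase_of_mem he, Finset.card_erase_of_mem hi0O, hcard]
      have hβ := hw'.2
      rw [huO, mapDomain_ind, mapDomain_ind, ← Finset.add_sum_erase _ _ he,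
        ← Finset.add_sum_erase _ _ hi0O, hsub] at hβ
      have h8 := Finsupp.single_left_injective (one_ne_zero) (add_right_cancel hβ)
      exact hne0 (hab _ _ hi0' h8)
    · have hu1 : u = ind C := eq_ind_of_sep hsep (h2.image q)
        (fun i hi => hCu i hi (by rintro rfl; exact he hi)) hCv h5
      have hi0C : i0 ∈ C := by
        by_contra hcc
        apply hi0
        rw [hu1, ind_apply, if_neg hcc]
      rw [← h3] at hi0C
      obtain ⟨j, hj, hj'⟩ := Finset.mem_image.1 hi0C
      by_cases h : α (q j) = α e0
      · simp only [hp', h, if_true] at hj'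
        rw [hj'] at hc1; exact hi0 hc1
      · simp only [hp', h, if_false] at hj'
        apply h
        rw [← (hpu _ (hqs j (h1 hj)).1).2, hj', hi0']
  refine ⟨hne, hdisj, huv, ?_⟩
  intro a b hEab hins
  have hqne : ∀ i ∈ O, ∀ j, v j ≠ 0 → i ≠ j := by
    rintro i hi j hj rfl
    rcases hdisj i with h | h
    · exact (memO i).2 hi h
    · exact hj h
  have stepβ : ∀ i ∈ O, (a i : ℤ) + a (q i) = b i + b (q i) := by
    intro i hi
    have hqi := hqv i ((memO i).2 hi)
    have hz : ∀ z, Inside α β u z → β z = β i → z = i ∨ z = q i := by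
      intro z hz hzi
      rcases chord z hz with h | h
      · exact Or.inl (hβu z ((memO z).1 h) i hi hzi)
      · right
        obtain ⟨j, hj, rfl⟩ := Finset.mem_image.1 ((memO' z).1 h)
        rw [hβu j hj i hi ((hqv j ((memO j).2 hj)).2.symm.trans hzi)]
    have := congrArg (fun f => f (β i)) hEab.2
    rw [mapDomain_two (hqne i hi _ hqi.1) hqi.2.symm
        (fun z h => hz z (hins z (Or.inl h))),
      mapDomain_two (hqne i hi _ hqi.1) hqi.2.symm
        (fun z h => hz z (hins z (Or.inr h)))] at this
    exact_mod_cast this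
  have stepα : ∀ i ∈ O, (a (p (q i)) : ℤ) + a (q i) = b (p (q i)) + b (q i) := by
    intro i hi
    have hqi := hqv i ((memO i).2 hi)
    have hpi := hpu _ hqi.1
    have hz : ∀ z, Inside α β u z → α z = α (p (q i)) → z = p (q i) ∨ z = q i := by
      intro z hz hzi
      rcases chord z hz with h | h
      · exact Or.inl (hαu z ((memO z).1 h) _ (memF i hi) hzi)
      · right
        obtain ⟨j, hj, rfl⟩ := Finset.mem_image.1 ((memO' z).1 h)
        exact hαv j hj i hi (hzi.trans hpi.2)
    have := congrArg (fun f => f (α (p (q i)))) hEab.1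
    rw [mapDomain_two (hqne _ (memF i hi) _ hqi.1) hpi.2
        (fun z h => hz z (hins z (Or.inl h))),
      mapDomain_two (hqne _ (memF i hi) _ hqi.1) hpi.2
        (fun z h => hz z (hins z (Or.inr h)))] at this
    exact_mod_cast this
  obtain ⟨i1, hi1⟩ := hu0
  obtain ⟨O2, hO2, -, -, huO2, -⟩ := key (O.filter fun i => (a i : ℤ) - b i = a i1 - b i1)
    ⟨i1, by simpa using (memO i1).1 hi1⟩
    (fun i hi => (memO i).2 (Finset.mem_filter.1 hi).1)
    (by
      intro i hi
      obtain ⟨hi, hi'⟩ := Finset.mem_filter.1 hi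
      refine Finset.mem_filter.2 ⟨memF i hi, ?_⟩
      have := stepβ i hi
      have := stepα i hi
      linarith)
  have hconst : ∀ i ∈ O, (a i : ℤ) - b i = a i1 - b i1 := by
    intro i hi
    have h := (memO i).2 hi
    rw [huO2, ind_apply] at h
    have h' : i ∈ O2 := by
      by_contra hc
      simp [hc] at h
    exact (Finset.mem_filter.1 (hO2 h')).2
  refine ⟨(a i1 : ℤ) - b i1, fun i => ?_⟩
  by_cases hiu : u i = 0
  · by_cases hiv : v i = 0
    · have : a i = 0 ∧ b i = 0 := by
        by_contra hc
        have hc' : a i ≠ 0 ∨ b i ≠ 0 := by tauto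
        rcases chord i (hins i hc') with h | h
        · exact h hiu
        · exact h hiv
      simp [hiu, hiv, this]
    · have hv1 : v i = 1 := by
        have := (memO' i).1 hiv
        rw [hvO, ind_apply, if_pos this]
      obtain ⟨j, hj, rfl⟩ := Finset.mem_image.1 ((memO' i).1 hiv)
      have e1 := stepβ j hj
      have e2 := hconst j hj
      rw [hiu, hv1]
      push_cast
      linarith
  · have hi := (memO i).1 hiu
    have hu1 : u i = 1 := by rw [huO, ind_apply, if_pos hi]
    have hv1 : v i = 0 := (hdisj i).resolve_left hiu
    rw [hu1, hv1, hconst i hi]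
    simp
end Comb

section Alg

theorem Good.inside {E V : Type*} {α β : E → V} {u v : E →₀ ℕ} (h : Good α β u v) {i : E}
    (hi : u i ≠ 0 ∨ v i ≠ 0) : Inside α β u i := by
  rcases hi with hi | hi
  · exact inside_self hi
  · exact h.2.2.1.symm.inside (inside_self hi)

theorem Good.eq_or_swap {E V : Type*} {α β : E → V} {u v u' v' : E →₀ ℕ} (h : Good α β u v)
    (h' : Good α β u' v') (h1 : ∀ i, u' i ≠ 0 ∨ v' i ≠ 0 → Inside α β u i)
    (h2 : ∀ i, u i ≠ 0 ∨ v i ≠ 0 → Inside α β u' i) :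
    (u' = u ∧ v' = v) ∨ (u' = v ∧ v' = u) := by
  obtain ⟨k, hk⟩ := h.2.2.2 u' v' h'.2.2.1 h1
  obtain ⟨l, hl⟩ := h'.2.2.2 u v h.2.2.1 h2
  obtain ⟨i, hi⟩ := Finsupp.ne_iff.1 h.1
  have hi' : (u i : ℤ) - v i ≠ 0 := by omega
  have hkl : k * l = 1 := by
    have e1 := hl i
    rw [hk i] at e1
    have : (k * l) * ((u i : ℤ) - v i) = 1 * ((u i : ℤ) - v i) := by linarith
    exact mul_right_cancel₀ hi' this
  rcases Int.eq_one_or_neg_one_of_mul_eq_one hkl with rfl | rfl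
  · left
    constructor <;> ext j <;> have := hk j <;> have := h.2.1 j <;> have := h'.2.1 j <;> omega
  · right
    constructor <;> ext j <;> have := hk j <;> have := h.2.1 j <;> have := h'.2.1 j <;> omega

/-- The support of a pair. -/
def dsupp {E : Type*} [Fintype E] (u v : E →₀ ℕ) : Finset E :=
  Finset.univ.filter fun i => u i ≠ v i

theorem Good.mem_dsupp {E V : Type*} [Fintype E] {α β : E → V} {u v : E →₀ ℕ}
    (h : Good α β u v) (i : E) : i ∈ dsupp u v ↔ u i ≠ 0 ∨ v i ≠ 0 := by
  have := h.2.1 i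
  simp only [dsupp, Finset.mem_filter, Finset.mem_univ, true_and]
  omega

theorem Good.of_dsupp {E V : Type*} [Fintype E] {α β : E → V} {u v u' v' : E →₀ ℕ}
    (h : Good α β u v) (h' : Good α β u' v') (hd : dsupp u v = dsupp u' v') :
    (u' = u ∧ v' = v) ∨ (u' = v ∧ v' = u) := by
  apply h.eq_or_swap h'
  · intro i hi
    rw [← h'.mem_dsupp, ← hd, h.mem_dsupp] at hi
    exact h.inside hi
  · intro i hi
    rw [← h.mem_dsupp, hd, h'.mem_dsupp] at hi
    exact h'.inside hi

theorem Good.of_eqv {E V : Type*} {α β : E → V} {u v u' v' : E →₀ ℕ}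
    (h : Good α β u v) (h' : Good α β u' v') (hd : Eqv α β u u') :
    (u' = u ∧ v' = v) ∨ (u' = v ∧ v' = u) := by
  apply h.eq_or_swap h'
  · intro i hi
    exact hd.symm.inside (h'.inside hi)
  · intro i hi
    exact hd.inside (h.inside hi)

theorem dsupp_comm {E : Type*} [Fintype E] (u v : E →₀ ℕ) : dsupp u v = dsupp v u := by
  ext i; simp [dsupp, ne_comm]

/-- Enumeration of good pairs up to swapping. -/
theorem exists_enum {E V : Type*} [Fintype E] (α β : E → V) :
    ∃ (r : ℕ) (U W : Fin r → E →₀ ℕ), (∀ t, Good α β (U t) (W t)) ∧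
      (Function.Injective fun t => dsupp (U t) (W t)) ∧
      ∀ u v, Good α β u v → ∃ t, dsupp (U t) (W t) = dsupp u v := by
  classical
  let T : Finset (Finset E) := Finset.univ.filter fun t => ∃ u v, Good α β u v ∧ dsupp u v = t
  have hT : ∀ t : T, ∃ u v, Good α β u v ∧ dsupp u v = (t : Finset E) := fun t =>
    (Finset.mem_filter.1 t.2).2
  choose U W h1 h2 using hT
  refine ⟨T.card, fun i => U (T.equivFin.symm i), fun i => W (T.equivFin.symm i),
    fun t => h1 _, ?_, ?_⟩
  · intro i j hij
    simp only [h2] at hij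
    exact T.equivFin.symm.injective (Subtype.ext hij)
  · intro u v h
    have hm : dsupp u v ∈ T := Finset.mem_filter.2 ⟨Finset.mem_univ _, u, v, h, rfl⟩
    exact ⟨T.equivFin ⟨_, hm⟩, by simp [h2]⟩

variable {K : Type*} [Field K] {E V : Type*}

/-- the binomial of a pair -/
def bin (K : Type*) [Field K] {E : Type*} (u v : E →₀ ℕ) : MvPolynomial E K :=
  monomial u 1 - monomial v 1

theorem bin_mem_of_good {α β : E → V} (hab : ∀ i j, α i = α j → β i = β j → i = j)
    (J : Ideal (MvPolynomial E K)) (hJ : ∀ u v, Good α β u v → bin K u v ∈ J) :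
    ∀ (N : ℕ) (u v : E →₀ ℕ), u.degree = N → Eqv α β u v → bin K u v ∈ J := by
  intro N
  induction N using Nat.strong_induction_on with
  | _ N ih =>
    have share : ∀ u v : E →₀ ℕ, u.degree = N → Eqv α β u v → (∃ i, u i ≠ 0 ∧ v i ≠ 0) →
        bin K u v ∈ J := by
      rintro u v hN huv ⟨i, hi1, hi2⟩
      obtain ⟨u, rfl⟩ := exists_single_add hi1
      obtain ⟨v, rfl⟩ := exists_single_add hi2
      have h1 := ih u.degree (by rw [← hN]; simp) u v rfl huv.of_add_left
      have h2 := J.mul_mem_left (monomial (Finsupp.single i 1) 1) h1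
      simpa [bin, mul_sub, monomial_mul] using h2
    intro u v hN huv
    by_cases hne : u = v
    · simp [bin, hne]
    by_cases hsep : FibSep α β u v
    · exact hJ _ _ (good_of_sep hab huv hne hsep)
    · simp only [FibSep] at hsep
      push Not at hsep
      obtain ⟨w, hw, ⟨i, hi⟩, ⟨j, hj⟩, -⟩ := hsep
      have hdeg : w.degree = N := by
        rw [← hN, ← Finsupp.degree_mapDomain α w, ← Finsupp.degree_mapDomain α u, hw.1]
      have e1 := share u w hN hw ⟨i, hi.2, hi.1⟩
      have e2 := share w v hdeg (hw.symm.trans huv) ⟨j, hj⟩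
      have : bin K u v = bin K u w + bin K w v := by simp [bin]
      rw [this]
      exact J.add_mem e1 e2

theorem ker_le {V' : Type*} (φ : MvPolynomial E K →ₐ[K] MvPolynomial V' K)
    (d : (E →₀ ℕ) → (V' →₀ ℕ)) (hφ : ∀ u, φ (monomial u 1) = monomial (d u) 1)
    (J : Ideal (MvPolynomial E K)) (hJ : ∀ u v, d u = d v → bin K u v ∈ J) :
    RingHom.ker φ ≤ J := by
  classical
  let sec : (V' →₀ ℕ) → (E →₀ ℕ) := Function.invFun d
  let θ : MvPolynomial V' K →ₗ[K] (MvPolynomial E K ⧸ J) :=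
    (basisMonomials V' K).constr K fun s => Ideal.Quotient.mk J (monomial (sec s) 1)
  have hθ : ∀ s, θ (monomial s 1) = Ideal.Quotient.mk J (monomial (sec s) 1) := by
    intro s
    have := (basisMonomials V' K).constr_basis K
      (fun s => Ideal.Quotient.mk J (monomial (sec s) 1)) s
    simpa using this
  have hcomp : θ ∘ₗ φ.toLinearMap = (Ideal.Quotient.mkₐ K J).toLinearMap := by
    apply (basisMonomials E K).ext
    intro u
    simp only [coe_basisMonomials, LinearMap.comp_apply, AlgHom.toLinearMap_apply, hφ, hθ]
    rw [Ideal.Quotient.mkₐ_eq_mk, Ideal.Quotient.eq]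
    exact hJ _ _ (Function.invFun_eq ⟨u, rfl⟩)
  intro f hf
  have h := LinearMap.congr_fun hcomp f
  simp only [LinearMap.comp_apply, AlgHom.toLinearMap_apply] at h
  rw [RingHom.mem_ker] at hf
  have hf' : φ f = 0 := hf
  rw [hf', map_zero, Ideal.Quotient.mkₐ_eq_mk] at h
  exact Ideal.Quotient.eq_zero_iff_mem.1 h.symm

theorem bin_mem_ker_iff {V' : Type*} (φ : MvPolynomial E K →ₐ[K] MvPolynomial V' K)
    (d : (E →₀ ℕ) → (V' →₀ ℕ)) (hφ : ∀ u, φ (monomial u 1) = monomial (d u) 1)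
    (u v : E →₀ ℕ) : bin K u v ∈ RingHom.ker φ ↔ d u = d v := by
  rw [RingHom.mem_ker, bin, map_sub, hφ, hφ, sub_eq_zero]
  constructor
  · intro h
    exact MvPolynomial.monomial_left_injective one_ne_zero h
  · intro h; rw [h]

/-- Restriction to the subgraph induced by the vertices of `u`. -/
def restr (K : Type*) [Field K] (α β : E → V) (u : E →₀ ℕ) :
    MvPolynomial E K →ₐ[K] MvPolynomial E K := by
  classical
  exact aeval fun i => if Inside α β u i then X i else 0

theorem restr_of_inside {α β : E → V} {u w : E →₀ ℕ} (h : ∀ i, w i ≠ 0 → Inside α β u i) :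
    restr K α β u (monomial w 1) = monomial w 1 := by
  classical
  rw [restr, aeval_monomial, monomial_eq]
  congr 1
  apply Finset.prod_congr rfl
  intro i hi
  simp [h i (by simpa using hi)]

theorem restr_of_not_inside {α β : E → V} {u w : E →₀ ℕ} {i : E} (hi : w i ≠ 0)
    (h : ¬ Inside α β u i) : restr K α β u (monomial w 1) = 0 := by
  classical
  rw [restr, aeval_monomial]
  apply mul_eq_zero_of_right
  apply Finset.prod_eq_zero (i := i) (by simpa using hi)
  simp [h, hi]

theorem Eqv.not_inside {α β : E → V} {u a b : E →₀ ℕ} (h : Eqv α β a b) {i : E} (hi : a i ≠ 0)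
    (hn : ¬ Inside α β u i) : ∃ j, b j ≠ 0 ∧ ¬ Inside α β u j := by
  by_contra! hc
  apply hn
  obtain ⟨j, hj, hj'⟩ := exists_of_mapDomain h.1 hi
  obtain ⟨k, hk, hk'⟩ := exists_of_mapDomain h.2 hi
  obtain ⟨x, hx, hx'⟩ := (hc j hj).1
  obtain ⟨y, hy, hy'⟩ := (hc k hk).2
  exact ⟨⟨x, hx, hx'.trans hj'⟩, y, hy, hy'.trans hk'⟩

theorem bar_lower [Fintype E] {V' : Type*} {α β : E → V}
    (φ : MvPolynomial E K →ₐ[K] MvPolynomial V' K)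
    (d : (E →₀ ℕ) → (V' →₀ ℕ)) (hφ : ∀ u, φ (monomial u 1) = monomial (d u) 1)
    (hd : ∀ u v, d u = d v ↔ Eqv α β u v) {r s : ℕ} (U W : Fin r → E →₀ ℕ)
    (hg : ∀ t, Good α β (U t) (W t)) (hinj : Function.Injective fun t => dsupp (U t) (W t))
    (F : Fin s → MvPolynomial E K) (hF : ∀ i, ∃ u v, F i = bin K u v)
    (hFI : ∀ i, F i ∈ RingHom.ker φ)
    (hrad : (Ideal.span (Set.range F)).radical = RingHom.ker φ) : r ≤ s := by
  classical
  choose a b hFab using hF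
  have hab : ∀ k, Eqv α β (a k) (b k) := fun k => by
    rw [← hd, ← bin_mem_ker_iff φ d hφ, ← hFab]; exact hFI k
  have main : ∀ t, ∃ k, dsupp (a k) (b k) = dsupp (U t) (W t) := by
    intro t
    by_contra! hno
    have hz : ∀ k, restr K α β (U t) (F k) = 0 := by
      intro k
      rw [hFab, bin, map_sub]
      by_cases hin : ∀ i, a k i ≠ 0 ∨ b k i ≠ 0 → Inside α β (U t) i
      · obtain ⟨c, hc⟩ := (hg t).2.2.2 _ _ (hab k) hin
        have hc0 : c = 0 := by
          by_contra hc0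
          apply hno k
          ext i
          simp only [dsupp, Finset.mem_filter, Finset.mem_univ, true_and]
          have h1 := hc i
          rw [not_iff_not]
          constructor
          · intro h
            rw [h, sub_self, eq_comm, mul_eq_zero] at h1
            have := h1.resolve_left hc0
            omega
          · intro h
            rw [h, sub_self, mul_zero] at h1
            omega
        have : a k = b k := by
          ext i
          have := hc i
          rw [hc0, zero_mul] at this
          omega
        rw [this, sub_self]
      · push Not at hin
        obtain ⟨i, hi, hi'⟩ := hin
        have : (∃ i, a k i ≠ 0 ∧ ¬ Inside α β (U t) i) ∧ (∃ i, b k i ≠ 0 ∧ ¬ Inside α β (U t) i) := by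
          rcases hi with hi | hi
          · exact ⟨⟨i, hi, hi'⟩, (hab k).not_inside hi hi'⟩
          · exact ⟨(hab k).symm.not_inside hi hi', ⟨i, hi, hi'⟩⟩
        obtain ⟨⟨x, hx, hx'⟩, y, hy, hy'⟩ := this
        rw [restr_of_not_inside hx hx', restr_of_not_inside hy hy', sub_self]
    have hle : Ideal.span (Set.range F) ≤ RingHom.ker (restr K α β (U t)) := by
      rw [Ideal.span_le]
      rintro _ ⟨k, rfl⟩
      exact hz k
    have hprime : (RingHom.ker (restr K α β (U t))).IsPrime := RingHom.ker_isPrime _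
    have hle2 := (hprime.radical_le_iff).2 hle
    rw [hrad] at hle2
    have hmem : bin K (U t) (W t) ∈ RingHom.ker φ :=
      (bin_mem_ker_iff φ d hφ _ _).2 ((hd _ _).2 (hg t).2.2.1)
    have h0 := hle2 hmem
    rw [RingHom.mem_ker, bin, map_sub, restr_of_inside (fun i hi => (hg t).inside (Or.inl hi)),
      restr_of_inside (fun i hi => (hg t).inside (Or.inr hi)), sub_eq_zero] at h0
    exact (hg t).1 (MvPolynomial.monomial_left_injective one_ne_zero h0)
  choose k hk using main
  have : Function.Injective k := by
    intro t t' h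
    apply hinj
    simp only
    rw [← hk t, ← hk t', h]
  simpa using Fintype.card_le_of_injective k this

theorem Good.fiber_trivial {α β : E → V} {u v b c : E →₀ ℕ} (h : Good α β u v) (hb : b ≤ u)
    (hbu : b ≠ u) (hbc : Eqv α β b c) : c = b := by
  have hbin : ∀ i, b i ≠ 0 → u i ≠ 0 := fun i hi => by have := hb i; omega
  have hb' : ∀ i, Inside α β b i → Inside α β u i := by
    rintro i ⟨⟨j, hj, hj'⟩, k, hk, hk'⟩
    exact ⟨⟨j, hbin j hj, hj'⟩, k, hbin k hk, hk'⟩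
  obtain ⟨k, hk⟩ := h.2.2.2 c b hbc.symm (by
    rintro i (hi | hi)
    · exact hb' i (hbc.symm.inside (inside_self hi))
    · exact hb' i (inside_self hi))
  rcases lt_trichotomy k 0 with hk0 | hk0 | hk0
  · exfalso
    apply hbu
    ext i
    refine le_antisymm (hb i) ?_
    by_cases hi : u i = 0
    · omega
    have hv := (h.2.1 i).resolve_left hi
    have h1 := hk i
    rw [hv] at h1
    push_cast at h1
    nlinarith [(Nat.cast_nonneg (c i) : (0:ℤ) ≤ c i), (Nat.cast_nonneg (u i) : (0:ℤ) ≤ u i)]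
  · ext i
    have := hk i
    rw [hk0, zero_mul] at this
    omega
  · exfalso
    have hv0 : ∃ i, v i ≠ 0 := by
      obtain ⟨i, hi⟩ := Finsupp.ne_iff.1 h.1
      by_cases hvi : v i = 0
      · obtain ⟨j, hj, _⟩ := exists_of_mapDomain h.2.2.1.1 (i := i) (by omega)
        exact ⟨j, hj⟩
      · exact ⟨i, hvi⟩
    obtain ⟨i, hi⟩ := hv0
    have hu := (h.2.1 i).resolve_right hi
    have hbi := hb i
    have h1 := hk i
    have hbi0 : b i = 0 := by omega
    rw [hu, hbi0] at h1
    push_cast at h1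
    have : (0:ℤ) < v i := by omega
    nlinarith [(Nat.cast_nonneg (c i) : (0:ℤ) ≤ c i)]

theorem coeff_eq_zero_of_fiber {V' : Type*} (φ : MvPolynomial E K →ₐ[K] MvPolynomial V' K)
    (d : (E →₀ ℕ) → (V' →₀ ℕ)) (hφ : ∀ u, φ (monomial u 1) = monomial (d u) 1)
    {b : E →₀ ℕ} (hb : ∀ c, d c = d b → c = b) {f : MvPolynomial E K}
    (hf : f ∈ RingHom.ker φ) : coeff b f = 0 := by
  classical
  have hcomp : (lcoeff K (d b)) ∘ₗ φ.toLinearMap = lcoeff K b := by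
    apply (basisMonomials E K).ext
    intro u
    simp only [coe_basisMonomials, LinearMap.comp_apply, AlgHom.toLinearMap_apply, hφ,
      lcoeff_apply, coeff_monomial]
    by_cases h : u = b
    · simp [h]
    · rw [if_neg h, if_neg (fun h' => h (hb u h'))]
  have h := LinearMap.congr_fun hcomp f
  simp only [LinearMap.comp_apply, AlgHom.toLinearMap_apply, lcoeff_apply] at h
  have hf' : φ f = 0 := hf
  rw [← h, hf', coeff_zero]

theorem mu_lower {V' : Type*} {α β : E → V}
    (φ : MvPolynomial E K →ₐ[K] MvPolynomial V' K)
    (d : (E →₀ ℕ) → (V' →₀ ℕ)) (hφ : ∀ u, φ (monomial u 1) = monomial (d u) 1)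
    (hd : ∀ u v, d u = d v ↔ Eqv α β u v) [Fintype E] {r s : ℕ} (U W : Fin r → E →₀ ℕ)
    (hg : ∀ t, Good α β (U t) (W t)) (hinj : Function.Injective fun t => dsupp (U t) (W t))
    (F : Fin s → MvPolynomial E K)
    (hspan : Ideal.span (Set.range F) = RingHom.ker φ) : r ≤ s := by
  classical
  have hψ : ∀ t (p f : MvPolynomial E K), f ∈ RingHom.ker φ →
      coeff (U t) (p * f) = coeff 0 p * coeff (U t) f := by
    intro t p f hf
    rw [coeff_mul, Finset.sum_eq_single (0, U t)]
    · rintro ⟨x, y⟩ hxy hne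
      have hxy' : x + y = U t := Finset.HasAntidiagonal.mem_antidiagonal.1 hxy
      have hyU : y ≠ U t := by
        rintro rfl
        apply hne
        have : x = 0 := by simpa using hxy'
        rw [this]
      have hy : y ≤ U t := by rw [← hxy']; exact le_add_self
      rw [coeff_eq_zero_of_fiber φ d hφ (fun c hc =>
        (hg t).fiber_trivial hy hyU ((hd _ _).1 hc.symm)) hf, mul_zero]
    · intro h
      exact absurd (Finset.HasAntidiagonal.mem_antidiagonal.2 (zero_add _)) h
  have hmem : ∀ t, ∃ c : Fin s → MvPolynomial E K, ∑ i, c i * F i = bin K (U t) (W t) := by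
    intro t
    have : bin K (U t) (W t) ∈ Ideal.span (Set.range F) := by
      rw [hspan]
      exact (bin_mem_ker_iff φ d hφ _ _).2 ((hd _ _).2 (hg t).2.2.1)
    exact (Ideal.mem_span_range_iff_exists_fun).1 this
  choose c hc using hmem
  have hFI : ∀ i, F i ∈ RingHom.ker φ := fun i => by
    rw [← hspan]; exact Ideal.subset_span ⟨i, rfl⟩
  let M : Matrix (Fin r) (Fin s) K := Matrix.of fun t i => coeff 0 (c t i)
  let N : Matrix (Fin s) (Fin r) K := Matrix.of fun i t => coeff (U t) (F i)
  have hMN : M * N = 1 := by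
    ext t t'
    rw [Matrix.mul_apply]
    have : ∑ i, M t i * N i t' = coeff (U t') (bin K (U t) (W t)) := by
      rw [← hc t, coeff_sum]
      exact Finset.sum_congr rfl fun i _ => (hψ t' (c t i) (F i) (hFI i)).symm
    rw [this, bin, coeff_sub, coeff_monomial, coeff_monomial, Matrix.one_apply]
    by_cases h : t = t'
    · subst h
      rw [if_pos rfl, if_pos rfl, if_neg (hg t).1.symm, sub_zero]
    · have hne : ¬ Eqv α β (U t) (U t') := by
        intro he
        apply h
        apply hinj
        simp only
        rcases (hg t).of_eqv (hg t') he with ⟨h1, h2⟩ | ⟨h1, h2⟩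
        · rw [h1, h2]
        · rw [h1, h2, dsupp_comm]
      rw [if_neg h, if_neg, if_neg, sub_zero]
      · intro h'
        exact hne (h' ▸ (hg t).2.2.1)
      · intro h'
        exact hne (h' ▸ ⟨rfl, rfl⟩)
  have h1 := Matrix.rank_mul_le_right M N
  rw [hMN, Matrix.rank_one, Fintype.card_fin] at h1
  exact h1.trans ((Matrix.rank_le_height N))

end Alg

theorem toricMap_monomial {K : Type*} [Field K] {n m : ℕ} (e : Fin m → Sym2 (Fin n))
    (α β : Fin m → Fin n) (he : ∀ i, e i = s(α i, β i)) (hne : ∀ i, α i ≠ β i)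
    (u : Fin m →₀ ℕ) :
    toricMap K e (monomial u 1) = monomial (u.mapDomain α + u.mapDomain β) 1 := by
  induction u using Finsupp.induction_linear with
  | zero => simp [toricMap]
  | add f g hf hg =>
    have h1 : (monomial (f + g) (1 : K)) = monomial f 1 * monomial g 1 := by
      simp [monomial_mul]
    rw [h1, map_mul, hf, hg, monomial_mul, Finsupp.mapDomain_add, Finsupp.mapDomain_add, one_mul]
    congr 1
    abel_nf
  | single i k =>
    have hX : ∏ j, (X j : MvPolynomial (Fin n) K) ^ incid e i j = X (α i) * X (β i) := by
      have : ∀ j, (X j : MvPolynomial (Fin n) K) ^ incid e i j =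
          if j ∈ ({α i, β i} : Finset (Fin n)) then X j else 1 := by
        intro j
        simp only [incid, he, Sym2.mem_iff, Finset.mem_insert, Finset.mem_singleton]
        split_ifs <;> simp
      rw [Finset.prod_congr rfl fun j _ => this j, Finset.prod_ite_mem, Finset.univ_inter,
        Finset.prod_pair (hne i)]
    rw [toricMap, aeval_monomial, Finsupp.prod_single_index (by simp), hX,
      Finsupp.mapDomain_single, Finsupp.mapDomain_single, map_one, one_mul, X, X, monomial_mul,
      monomial_pow]
    simp

theorem deg_eq_iff {n m : ℕ} (α β : Fin m → Fin n) (A : Set (Fin n)) (hα : ∀ i, α i ∈ A)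
    (hβ : ∀ i, β i ∉ A) (u v : Fin m →₀ ℕ) :
    u.mapDomain α + u.mapDomain β = v.mapDomain α + v.mapDomain β ↔ Eqv α β u v := by
  constructor
  · intro h
    have hA : ∀ w : Fin m →₀ ℕ, ∀ j ∉ A, (w.mapDomain α) j = 0 := fun w j hj =>
      Finsupp.mapDomain_of_notMem_range _ _ (by rintro ⟨i, rfl⟩; exact hj (hα i))
    have hB : ∀ w : Fin m →₀ ℕ, ∀ j ∈ A, (w.mapDomain β) j = 0 := fun w j hj =>
      Finsupp.mapDomain_of_notMem_range _ _ (by rintro ⟨i, rfl⟩; exact hβ i hj)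
    constructor <;> ext j <;> have hj := DFunLike.congr_fun h j <;>
      simp only [Finsupp.add_apply] at hj <;> by_cases hjA : j ∈ A
    · simpa [hB _ j hjA] using hj
    · simp [hA _ j hjA]
    · simp [hB _ j hjA]
    · simpa [hA _ j hjA] using hj
  · intro h
    rw [h.1, h.2]

/-- For a finite connected bipartite graph `G`, the binomial arithmetical
rank of the toric ideal `I_G` equals its minimal number of generators. -/
theorem bar_toricIdeal_eq_mu_of_bipartite {K : Type*} [Field K] [IsAlgClosed K]
    {n m : ℕ} (e : Fin m → Sym2 (Fin n))
    (he : Function.Injective e) (hl : ∀ i, ¬ (e i).IsDiag)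
    (hconn : (SimpleGraph.fromEdgeSet (Set.range e)).Connected)
    (hbip : IsBipartite e) :
    bar (toricIdeal K e) = mu (toricIdeal K e) := by
  obtain ⟨A, hA⟩ := hbip
  have hex : ∀ i, ∃ v w, e i = s(v, w) ∧ v ∈ A ∧ w ∉ A := by
    intro i
    induction hi : e i using Sym2.ind with
    | _ v w =>
      rcases hA i v w hi with h | h
      · exact ⟨v, w, rfl, h⟩
      · exact ⟨w, v, Sym2.eq_swap, h.2, h.1⟩
  choose α β heq hα hβ using hex
  have hne : ∀ i, α i ≠ β i := fun i h => hβ i (h ▸ hα i)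
  have hab : ∀ i j, α i = α j → β i = β j → i = j := fun i j h1 h2 =>
    he (by rw [heq i, heq j, h1, h2])
  obtain ⟨r, U, W, hg, hinj, hall⟩ := exists_enum α β
  let d : (Fin m →₀ ℕ) → (Fin n →₀ ℕ) := fun u => u.mapDomain α + u.mapDomain β
  have hφ : ∀ u, toricMap K e (monomial u 1) = monomial (d u) 1 :=
    toricMap_monomial e α β heq hne
  have hd : ∀ u v, d u = d v ↔ Eqv α β u v := deg_eq_iff α β A hα hβ
  let B : Fin r → MvPolynomial (Fin m) K := fun t => bin K (U t) (W t)
  have hBI : ∀ t, B t ∈ toricIdeal K e := fun t =>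
    (bin_mem_ker_iff _ d hφ _ _).2 ((hd _ _).2 (hg t).2.2.1)
  have hspan : Ideal.span (Set.range B) = toricIdeal K e := by
    apply le_antisymm
    · rw [Ideal.span_le]
      rintro _ ⟨t, rfl⟩
      exact hBI t
    · refine ker_le _ d hφ _ fun u v huv => ?_
      refine bin_mem_of_good hab _ (fun u v huv => ?_) _ u v rfl ((hd _ _).1 huv)
      obtain ⟨t, ht⟩ := hall u v huv
      have hm : B t ∈ Ideal.span (Set.range B) := Ideal.subset_span ⟨t, rfl⟩
      rcases (hg t).of_dsupp huv ht with ⟨h1, h2⟩ | ⟨h1, h2⟩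
      · rw [h1, h2]; exact hm
      · have : bin K u v = - B t := by simp [B, bin, h1, h2]
        rw [this]
        exact neg_mem hm
  have hprime : (toricIdeal K e).IsPrime := RingHom.ker_isPrime _
  have hbar : bar (toricIdeal K e) = r := by
    apply le_antisymm
    · exact Nat.sInf_le ⟨B, fun t => ⟨U t, W t, rfl⟩, hBI, by rw [hspan, hprime.radical]⟩
    · apply le_csInf
      · exact ⟨r, B, fun t => ⟨U t, W t, rfl⟩, hBI, by rw [hspan, hprime.radical]⟩
      · rintro s ⟨F, h1, h2, h3⟩
        exact bar_lower _ d hφ hd U W hg hinj F h1 h2 h3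
  have hmu : mu (toricIdeal K e) = r := by
    apply le_antisymm
    · exact Nat.sInf_le ⟨B, hspan⟩
    · apply le_csInf
      · exact ⟨r, B, hspan⟩
      · rintro s ⟨F, h1⟩
        exact mu_lower _ d hφ hd U W hg hinj F h1
  rw [hbar, hmu]
end
end

section
/- Let G be a finite connected simple graph such that the toric ideal I_G is generated by quadratic binomials. Then the binomial arithmetical rank of I_G equals its minimal number of generators: bar(I_G) = μ(I_G). -/
open MvPolynomial

noncomputable section

namespace BarToric

section upper

variable {K : Type*} [Field K] {m : ℕ}

lemma hc_mul_of_mem_span (S : Set (MvPolynomial (Fin m) K))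
    (hS : ∀ p ∈ S, p.IsHomogeneous 2) (q : MvPolynomial (Fin m) K) (hq : q ∈ Ideal.span S) :
    ∀ c : MvPolynomial (Fin m) K, homogeneousComponent 2 (c * q) =
      coeff 0 c • homogeneousComponent 2 q := by
  induction hq using Submodule.span_induction with
  | mem q hq =>
    intro c
    induction c using MvPolynomial.induction_on' with
    | monomial u a =>
      have h1 : (monomial u a * q).IsHomogeneous (u.degree + 2) :=
        (isHomogeneous_monomial a rfl).mul (hS q hq)
      rw [homogeneousComponent_of_mem h1, homogeneousComponent_of_mem (hS q hq)]
      by_cases hu : u = 0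
      · subst hu
        simp [MvPolynomial.smul_eq_C_mul]
      · have : u.degree ≠ 0 := by simpa [Finsupp.degree_eq_zero_iff] using hu
        rw [if_neg (by omega), coeff_monomial, if_neg hu, zero_smul]
    | add p p' hp hp' =>
      rw [add_mul, map_add, hp, hp', coeff_add, add_smul]
  | zero => intro c; simp
  | add x y _ _ hx hy => intro c; rw [mul_add, map_add, hx, hy, map_add, smul_add]
  | smul r x _ hx =>
    intro c
    rw [smul_eq_mul, ← mul_assoc, hx, hx, smul_smul]
    congr 1
    simp [← constantCoeff_eq]

lemma quad_homog (i j k l : Fin m) :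
    (X i * X j - X k * X l : MvPolynomial (Fin m) K).IsHomogeneous 2 :=
  ((isHomogeneous_X K i).mul (isHomogeneous_X K j)).sub
    ((isHomogeneous_X K k).mul (isHomogeneous_X K l))

lemma XX_eq (i j : Fin m) : (X i * X j : MvPolynomial (Fin m) K) =
    monomial (Finsupp.single i 1 + Finsupp.single j 1) 1 := by
  simp [X, monomial_mul]

lemma exists_min_gens (S : Set (MvPolynomial (Fin m) K))
    (hS : ∀ p ∈ S, ∃ i j k l : Fin m, p = X i * X j - X k * X l) :
    ∃ d, (∃ F : Fin d → MvPolynomial (Fin m) K, (∀ i, IsBinomial (F i)) ∧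
      Ideal.span (Set.range F) = Ideal.span S) ∧
      ∀ s, ∀ G : Fin s → MvPolynomial (Fin m) K,
        Ideal.span (Set.range G) = Ideal.span S → d ≤ s := by
  have hfin : S.Finite := by
    apply Set.Finite.subset (Set.finite_range (fun t : Fin m × Fin m × Fin m × Fin m =>
      (X t.1 * X t.2.1 - X t.2.2.1 * X t.2.2.2 : MvPolynomial (Fin m) K)))
    intro p hp
    obtain ⟨i, j, k, l, rfl⟩ := hS p hp
    exact ⟨(i, j, k, l), rfl⟩
  have hhom : ∀ p ∈ S, p.IsHomogeneous 2 := by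
    intro p hp
    obtain ⟨i, j, k, l, rfl⟩ := hS p hp
    exact quad_homog i j k l
  obtain ⟨b, hbS, hspan, hli⟩ := exists_linearIndependent K S
  have hbfin : b.Finite := hfin.subset hbS
  have : Fintype b := hbfin.fintype
  have hI : Ideal.span b = Ideal.span S := by
    apply le_antisymm (Ideal.span_mono hbS)
    rw [Ideal.span_le]
    intro p hp
    have h1 : p ∈ Submodule.span K b := hspan ▸ Submodule.subset_span hp
    have h2 : Submodule.span K b ≤ (Ideal.span b).restrictScalars K :=
      Submodule.span_le.2 (fun x hx => Ideal.subset_span hx)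
    exact h2 h1
  refine ⟨Fintype.card b, ⟨fun i => ((Fintype.equivFin b).symm i : MvPolynomial (Fin m) K),
    ?_, ?_⟩, ?_⟩
  · intro i
    obtain ⟨i, j, k, l, h⟩ := hS _ (hbS ((Fintype.equivFin b).symm i).2)
    refine ⟨Finsupp.single i 1 + Finsupp.single j 1, Finsupp.single k 1 + Finsupp.single l 1, ?_⟩
    dsimp only
    rw [h, XX_eq, XX_eq]
  · rw [← hI]
    congr 1
    ext p
    constructor
    · rintro ⟨i, rfl⟩
      exact ((Fintype.equivFin b).symm i).2
    · intro hp
      exact ⟨Fintype.equivFin b ⟨p, hp⟩, by simp⟩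
  · intro s G hG
    have hsub : b ⊆ (Submodule.span K (Set.range fun i => homogeneousComponent 2 (G i)) : Set _) := by
      intro p hp
      have h1 : p ∈ Ideal.span (Set.range G) := by
        rw [hG]; exact Ideal.subset_span (hbS hp)
      obtain ⟨c, hc⟩ := (Ideal.mem_span_range_iff_exists_fun).1 h1
      have h2 : homogeneousComponent 2 p = p := by
        rw [homogeneousComponent_of_mem (hhom p (hbS hp)), if_pos rfl]
      rw [SetLike.mem_coe, ← h2, ← hc, map_sum]
      refine Submodule.sum_mem _ fun i _ => ?_
      rw [hc_mul_of_mem_span S hhom (G i) (by rw [← hG]; exact Ideal.subset_span ⟨i, rfl⟩)]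
      exact Submodule.smul_mem _ _ (Submodule.subset_span ⟨i, rfl⟩)
    have h3 : Set.finrank K (Set.range fun i => homogeneousComponent 2 (G i)) ≤ Fintype.card (Fin s) :=
      finrank_range_le_card _
    have : FiniteDimensional K (Submodule.span K (Set.range fun i => homogeneousComponent 2 (G i))) :=
      FiniteDimensional.span_of_finite K (Set.finite_range _)
    have h4 := Submodule.finrank_mono (Submodule.span_le.2 hsub)
    have h5 := finrank_span_eq_card hli
    rw [Subtype.range_coe] at h5
    rw [Set.finrank, Fintype.card_fin] at h3
    calc Fintype.card b = _ := h5.symm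
      _ ≤ _ := h4
      _ ≤ s := h3

end upper

section lower

variable {n m : ℕ} (e : Fin m → Sym2 (Fin n))

/-- degree vector -/
def dv (u : Fin m →₀ ℕ) : Fin n →₀ ℕ :=
  Finsupp.equivFunOnFinite.symm (fun j => ∑ k, u k * incid e k j)

lemma dv_apply (u : Fin m →₀ ℕ) (j : Fin n) : dv e u j = ∑ k, u k * incid e k j := rfl

lemma dv_ne_zero (u : Fin m →₀ ℕ) (j : Fin n) : dv e u j ≠ 0 ↔ ∃ k, u k ≠ 0 ∧ j ∈ e k := by
  rw [dv_apply]
  simp [incid, and_comm]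

lemma dv_pair (i j : Fin m) (v : Fin n) :
    dv e (Finsupp.single i 1 + Finsupp.single j 1) v = incid e i v + incid e j v := by
  rw [dv_apply]
  simp [add_mul, Finset.sum_add_distrib, Finsupp.single_apply]

variable {K : Type*} [Field K]

lemma toricMap_monomial (u : Fin m →₀ ℕ) :
    toricMap K e (monomial u 1) = monomial (dv e u) 1 := by
  rw [toricMap, aeval_monomial, map_one, one_mul, Finsupp.prod_fintype _ _ (by simp)]
  rw [monomial_eq, Finsupp.prod_fintype _ _ (by simp)]
  simp only [map_one, one_mul, dv_apply, ← Finset.prod_pow, ← pow_mul]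
  rw [Finset.prod_comm]
  refine Finset.prod_congr rfl fun j _ => ?_
  rw [Finset.prod_pow_eq_pow_sum]
  simp [mul_comm]

lemma mem_toric (u v : Fin m →₀ ℕ) :
    (monomial u 1 - monomial v 1 : MvPolynomial (Fin m) K) ∈ toricIdeal K e ↔
      dv e u = dv e v := by
  rw [toricIdeal, RingHom.mem_ker, map_sub, toricMap_monomial, toricMap_monomial, sub_eq_zero]
  exact ⟨fun h => monomial_left_injective one_ne_zero h, fun h => by rw [h]⟩

/-- squarefree quadratic monomials with vertex support `W` -/
def T (W : Finset (Fin n)) : Set (Fin m →₀ ℕ) :=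
  {u | ∃ i j, (∀ v, v ∈ e i → v ∉ e j) ∧ u = Finsupp.single i 1 + Finsupp.single j 1 ∧
    ∀ v, v ∈ W ↔ v ∈ e i ∨ v ∈ e j}

lemma dv_of_T {W : Finset (Fin n)} {u : Fin m →₀ ℕ} (hu : u ∈ T e W) (v : Fin n) :
    dv e u v = if v ∈ W then 1 else 0 := by
  obtain ⟨i, j, hd, rfl, hW⟩ := hu
  rw [dv_pair]
  have := hd v
  simp only [incid, hW v]
  grind

lemma sym2_ext_of_subset {a b : Sym2 (Fin n)} (ha : ¬ a.IsDiag) (hb : ¬ b.IsDiag)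
    (h : ∀ v, v ∈ a → v ∈ b) : a = b := by
  induction a using Sym2.ind with | _ x y =>
  induction b using Sym2.ind with | _ z w =>
  have h1 := h x
  have h2 := h y
  simp at *
  grind

lemma T_ncard_le (he : Function.Injective e) (hl : ∀ i, ¬ (e i).IsDiag)
    (W : Finset (Fin n)) : (T e W).Finite ∧ (T e W).ncard ≤ 3 := by
  by_cases hne : (T e W).Nonempty
  swap
  · rw [Set.not_nonempty_iff_eq_empty] at hne
    simp [hne]
  obtain ⟨u0, i0, j0, hd0, hu0, hW0⟩ := hne
  obtain ⟨a, b, hab⟩ : ∃ a b, e i0 = s(a, b) := by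
    induction h : e i0 using Sym2.ind with | _ x y => exact ⟨x, y, rfl⟩
  obtain ⟨c, d, hcd⟩ : ∃ a b, e j0 = s(a, b) := by
    induction h : e j0 using Sym2.ind with | _ x y => exact ⟨x, y, rfl⟩
  have hWabcd : ∀ v, v ∈ W ↔ (v = a ∨ v = b) ∨ (v = c ∨ v = d) := by
    intro v; rw [hW0, hab, hcd]; simp
  have key : ∀ u ∈ T e W, ∃ p ∈ ({b, c, d} : Finset (Fin n)), ∃ i j,
      u = Finsupp.single i 1 + Finsupp.single j 1 ∧ e i = s(a, p) ∧
      ∀ v, v ∈ e j ↔ v ∈ W ∧ v ∉ e i := by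
    rintro u ⟨i, j, hd, hu, hW⟩
    have haW : a ∈ W := by simp [hWabcd]
    have aux : ∀ i j, (∀ v, v ∈ e i → v ∉ e j) → u = Finsupp.single i 1 + Finsupp.single j 1 →
      (∀ v, v ∈ W ↔ v ∈ e i ∨ v ∈ e j) → a ∈ e i → ∃ p ∈ ({b, c, d} : Finset (Fin n)), ∃ i j,
      u = Finsupp.single i 1 + Finsupp.single j 1 ∧ e i = s(a, p) ∧
      ∀ v, v ∈ e j ↔ v ∈ W ∧ v ∉ e i := by
      intro i j hd hu hW ha
      obtain ⟨p, hp⟩ := Sym2.mem_iff_exists.1 ha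
      have hpa : a ≠ p := by
        have := hl i
        rw [hp] at this
        simpa using this
      refine ⟨p, ?_, i, j, hu, hp, ?_⟩
      · have : p ∈ W := (hW p).2 (Or.inl (by rw [hp]; simp))
        rw [hWabcd] at this
        simp
        grind
      · intro v
        have := hW v
        have := hd v
        tauto
    rcases (hW a).1 haW with ha | ha
    · exact aux i j hd hu hW ha
    · exact aux j i (fun v h1 h2 => hd v h2 h1) (by rw [hu, add_comm])
        (fun v => by rw [hW v, or_comm]) ha
  have : Nonempty (Fin n) := ⟨a⟩
  have : Nonempty (Fin m) := ⟨i0⟩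
  choose! f hf g1 g2 hu h1 h2 using key
  have hinj : Set.InjOn f (T e W) := by
    intro u hu' w hw hfu
    have e1 : g1 u = g1 w := he (by rw [h1 u hu', h1 w hw, hfu])
    have e2 : g2 u = g2 w := he (Sym2.ext (fun v => by rw [h2 u hu', h2 w hw, e1]))
    rw [hu u hu', hu w hw, e1, e2]
  have hmaps : Set.MapsTo f (T e W) (({b, c, d} : Finset (Fin n)) : Set (Fin n)) :=
    fun u hu => hf u hu
  refine ⟨Set.Finite.of_injOn hmaps hinj (Finset.finite_toSet _), ?_⟩
  calc (T e W).ncard ≤ (({b, c, d} : Finset (Fin n)) : Set (Fin n)).ncard :=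
        Set.ncard_le_ncard_of_injOn f hmaps hinj (Finset.finite_toSet _)
    _ ≤ 3 := by rw [Set.ncard_coe_finset]; exact Finset.card_le_three

/-- quadratic binomials in the ideal are trivial or in the same `T`. -/
lemma quad_cases (he : Function.Injective e) (hl : ∀ i, ¬ (e i).IsDiag) (i j k l : Fin m)
    (h : dv e (Finsupp.single i 1 + Finsupp.single j 1) =
      dv e (Finsupp.single k 1 + Finsupp.single l 1)) :
    (Finsupp.single i 1 + Finsupp.single j 1 : Fin m →₀ ℕ) =
      Finsupp.single k 1 + Finsupp.single l 1 ∨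
    ∃ W, (Finsupp.single i 1 + Finsupp.single j 1 : Fin m →₀ ℕ) ∈ T e W ∧
      (Finsupp.single k 1 + Finsupp.single l 1 : Fin m →₀ ℕ) ∈ T e W := by
  have h' : ∀ v, incid e i v + incid e j v = incid e k v + incid e l v := by
    intro v
    rw [← dv_pair, ← dv_pair, h]
  by_cases hd : ∀ v, v ∈ e i → v ∉ e j
  · right
    refine ⟨Finset.univ.filter (fun v => v ∈ e i ∨ v ∈ e j), ⟨i, j, hd, rfl, by simp⟩,
      ⟨k, l, ?_, rfl, ?_⟩⟩
    · intro v
      have := h' v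
      have := hd v
      simp only [incid] at *
      grind
    · intro v
      have := h' v
      have := hd v
      simp only [incid, Finset.mem_filter, Finset.mem_univ, true_and] at *
      grind
  · left
    push Not at hd
    obtain ⟨a, hai, haj⟩ := hd
    have hkl : a ∈ e k ∧ a ∈ e l := by
      have := h' a
      simp only [incid] at this
      grind
    obtain ⟨b, hb⟩ := Sym2.mem_iff_exists.1 hai
    obtain ⟨c, hc⟩ := Sym2.mem_iff_exists.1 haj
    obtain ⟨b', hb'⟩ := Sym2.mem_iff_exists.1 hkl.1
    obtain ⟨c', hc'⟩ := Sym2.mem_iff_exists.1 hkl.2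
    have n1 := hl i
    have n2 := hl j
    have n3 := hl k
    have n4 := hl l
    simp only [incid, hb, hc, hb', hc', Sym2.mk_isDiag_iff, Sym2.mem_iff] at h' n1 n2 n3 n4
    have q1 := h' b
    have q2 := h' c
    have q3 := h' b'
    have q4 := h' c'
    have : (b = b' ∧ c = c') ∨ (b = c' ∧ c = b') := by grind
    rcases this with ⟨rfl, rfl⟩ | ⟨rfl, rfl⟩
    · rw [he (hb.trans hb'.symm), he (hc.trans hc'.symm)]
    · rw [he (hb.trans hc'.symm), he (hc.trans hb'.symm), add_comm]

/-- evaluation of a monomial at a 0/1 point -/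
lemma eval_ind (A : Finset (Fin m)) (u : Fin m →₀ ℕ) :
    eval (fun k => if k ∈ A then (1 : K) else 0) (monomial u 1) =
      if u.support ⊆ A then 1 else 0 := by
  rw [eval_monomial, one_mul, Finsupp.prod]
  split_ifs with h
  · exact Finset.prod_eq_one fun k hk => by rw [if_pos (h hk), one_pow]
  · obtain ⟨k, hk, hkA⟩ := Finset.not_subset.1 h
    exact Finset.prod_eq_zero hk (by rw [if_neg hkA, zero_pow (Finsupp.mem_support_iff.1 hk)])

/-- key support lemma -/
lemma supp_eq (he : Function.Injective e) (hl : ∀ i, ¬ (e i).IsDiag)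
    {i j : Fin m} {p q : Fin m →₀ ℕ} (h : dv e p = dv e q)
    (hp : p.support ⊆ {i, j}) (hq : ¬ q.support ⊆ {i, j}) : j ∈ p.support := by
  by_contra hj
  apply hq
  intro k hk
  rw [Finsupp.mem_support_iff] at hk
  have : e k = e i := by
    apply sym2_ext_of_subset (hl k) (hl i)
    intro v hv
    have h1 : dv e q v ≠ 0 := (dv_ne_zero e q v).2 ⟨k, hk, hv⟩
    rw [← h] at h1
    obtain ⟨k', hk', hv'⟩ := (dv_ne_zero e p v).1 h1
    have := hp (Finsupp.mem_support_iff.2 hk')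
    simp only [Finset.mem_insert, Finset.mem_singleton] at this
    rcases this with rfl | rfl
    · exact hv'
    · exact absurd (Finsupp.mem_support_iff.2 hk') hj
  simp [he this]

lemma supp_eq' (he : Function.Injective e) (hl : ∀ i, ¬ (e i).IsDiag)
    {i j : Fin m} {p q : Fin m →₀ ℕ} (h : dv e p = dv e q)
    (hp : p.support ⊆ {i, j}) (hq : ¬ q.support ⊆ {i, j}) : p.support = {i, j} := by
  apply Finset.Subset.antisymm hp
  intro k hk
  simp only [Finset.mem_insert, Finset.mem_singleton] at hk
  rcases hk with rfl | rfl
  · rw [Finset.pair_comm] at hp hq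
    exact supp_eq e he hl h hp hq
  · exact supp_eq e he hl h hp hq

lemma pair_support (i j : Fin m) :
    (Finsupp.single i 1 + Finsupp.single j 1 : Fin m →₀ ℕ).support = {i, j} := by
  ext k
  simp [Finsupp.single_apply]
  grind

lemma T_supp_inj {W : Finset (Fin n)} {u w : Fin m →₀ ℕ} (hu : u ∈ T e W)
    (hw : w ∈ T e W) (h : w.support ⊆ u.support) : u = w := by
  obtain ⟨i, j, hd, rfl, hW⟩ := hu
  obtain ⟨k, l, hd', rfl, hW'⟩ := hw
  rw [pair_support, pair_support] at h
  have hk := h (Finset.mem_insert_self k _)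
  have hl' := h (Finset.mem_insert_of_mem (Finset.mem_singleton_self l))
  have hkl : k ≠ l := by
    rintro rfl
    induction hh : e k using Sym2.ind with | _ x y =>
    exact hd' x (by simp [hh]) (by simp [hh])
  simp only [Finset.mem_insert, Finset.mem_singleton] at hk hl'
  rcases hk with rfl | rfl <;> rcases hl' with rfl | rfl
  · exact absurd rfl hkl
  · rfl
  · rw [add_comm]
  · exact absurd rfl hkl

lemma dv_support_of_supp {W : Finset (Fin n)} {u p : Fin m →₀ ℕ} (hu : u ∈ T e W)
    (h : p.support = u.support) : (dv e p).support = W := by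
  ext v
  rw [Finsupp.mem_support_iff, dv_ne_zero]
  have h1 := dv_of_T e hu v
  have h2 := dv_ne_zero e u v
  have h3 : ∀ k, p k ≠ 0 ↔ u k ≠ 0 := by
    intro k
    rw [← Finsupp.mem_support_iff, h, Finsupp.mem_support_iff]
  simp only [h3, ← h2, h1]
  simp

/-- every element of a nontrivial fiber is hit by some binomial. -/
lemma exists_hit (he : Function.Injective e) (hl : ∀ i, ¬ (e i).IsDiag)
    {s : ℕ} (p q : Fin s → Fin m →₀ ℕ) (hpq : ∀ r, dv e (p r) = dv e (q r))
    (hrad : (Ideal.span (Set.range fun r => (monomial (p r) 1 - monomial (q r) 1 :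
      MvPolynomial (Fin m) K))).radical = toricIdeal K e)
    {W : Finset (Fin n)} {u w : Fin m →₀ ℕ} (hu : u ∈ T e W) (hw : w ∈ T e W) (hne : u ≠ w) :
    ∃ r, (dv e (p r)).support = W ∧ ((p r).support = u.support ∨ (q r).support = u.support) := by
  by_contra hcon
  push Not at hcon
  have hmem : (monomial u 1 - monomial w 1 : MvPolynomial (Fin m) K) ∈ toricIdeal K e := by
    rw [mem_toric]
    ext v
    rw [dv_of_T e hu, dv_of_T e hw]
  rw [← hrad] at hmem
  let ev := eval (fun k => if k ∈ u.support then (1 : K) else 0)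
  have hle : (Ideal.span (Set.range fun r => (monomial (p r) 1 - monomial (q r) 1 :
      MvPolynomial (Fin m) K))) ≤ RingHom.ker ev := by
    rw [Ideal.span_le]
    rintro _ ⟨r, rfl⟩
    rw [SetLike.mem_coe, RingHom.mem_ker, map_sub, eval_ind, eval_ind]
    obtain ⟨i, j, hd, huij, hW⟩ := id hu
    have hs : u.support = {i, j} := by rw [huij, pair_support]
    by_cases h1 : (p r).support ⊆ u.support <;> by_cases h2 : (q r).support ⊆ u.support
    · simp [h1, h2]
    · exfalso
      rw [hs] at h1 h2
      have h3 := supp_eq' e he hl (hpq r) h1 h2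
      rw [← hs] at h3
      exact (hcon r (dv_support_of_supp e hu h3)).1 h3
    · exfalso
      rw [hs] at h1 h2
      have h3 := supp_eq' e he hl (hpq r).symm h2 h1
      rw [← hs] at h3
      exact (hcon r (by rw [hpq]; exact dv_support_of_supp e hu h3)).2 h3
    · simp [h1, h2]
  have hprime : (RingHom.ker ev).IsPrime := RingHom.ker_isPrime ev
  have hm2 := (hprime.radical_le_iff.2 hle) hmem
  rw [RingHom.mem_ker, map_sub, eval_ind, eval_ind, if_pos (Finset.Subset.refl _),
    if_neg (fun h => hne (T_supp_inj e hu hw h))] at hm2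
  simp at hm2

/-- local construction of generators -/
lemma local_gens (he : Function.Injective e) (hl : ∀ i, ¬ (e i).IsDiag)
    {s : ℕ} (p q : Fin s → Fin m →₀ ℕ) (hpq : ∀ r, dv e (p r) = dv e (q r))
    (hrad : (Ideal.span (Set.range fun r => (monomial (p r) 1 - monomial (q r) 1 :
      MvPolynomial (Fin m) K))).radical = toricIdeal K e) (W : Finset (Fin n)) :
    ∃ g : Fin s → MvPolynomial (Fin m) K, (∀ r, g r ∈ toricIdeal K e) ∧
      ∀ u ∈ T e W, ∀ w ∈ T e W, (monomial u 1 - monomial w 1 : MvPolynomial (Fin m) K) ∈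
        Ideal.span (g '' {r | (dv e (p r)).support = W}) := by
  obtain ⟨hfin, hcard⟩ := T_ncard_le e he hl W
  have hI : ∀ u ∈ T e W, ∀ w ∈ T e W,
      (monomial u 1 - monomial w 1 : MvPolynomial (Fin m) K) ∈ toricIdeal K e := by
    intro u hu w hw
    rw [mem_toric]
    ext v
    rw [dv_of_T e hu, dv_of_T e hw]
  have hhit := fun u w hu hw hne => exists_hit (K := K) e he hl p q hpq hrad (W := W)
    (u := u) (w := w) hu hw hne
  by_cases h1 : (T e W).ncard ≤ 1
  · refine ⟨0, fun r => Ideal.zero_mem _, ?_⟩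
    intro u hu w hw
    rw [(Set.ncard_le_one hfin).1 h1 u hu w hw, sub_self]
    exact Ideal.zero_mem _
  by_cases h2 : (T e W).ncard = 2
  · obtain ⟨x, y, hxy, hT⟩ := Set.ncard_eq_two.1 h2
    have hx : x ∈ T e W := by simp [hT]
    have hy : y ∈ T e W := by simp [hT]
    obtain ⟨r, hr, -⟩ := hhit x y hx hy hxy
    refine ⟨fun _ => monomial x 1 - monomial y 1, fun _ => hI x hx y hy, ?_⟩
    have hb : (monomial x 1 - monomial y 1 : MvPolynomial (Fin m) K) ∈
        Ideal.span ((fun _ => (monomial x 1 - monomial y 1 : MvPolynomial (Fin m) K)) ''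
          {r | (dv e (p r)).support = W}) := Ideal.subset_span ⟨r, hr, rfl⟩
    intro u hu w hw
    rw [hT] at hu hw
    rcases hu with rfl | rfl <;> rcases hw with rfl | rfl
    · simp
    · exact hb
    · have := neg_mem hb
      rwa [neg_sub] at this
    · simp
  · have h3 : (T e W).ncard = 3 := by omega
    obtain ⟨x, y, z, hxy, hxz, hyz, hT⟩ := Set.ncard_eq_three.1 h3
    have hx : x ∈ T e W := by simp [hT]
    have hy : y ∈ T e W := by simp [hT]
    have hz : z ∈ T e W := by simp [hT]
    obtain ⟨r1, r2, hr1, hr2, hr⟩ : ∃ r1 r2, (dv e (p r1)).support = W ∧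
        (dv e (p r2)).support = W ∧ r1 ≠ r2 := by
      by_contra hcon
      push Not at hcon
      obtain ⟨rx, hrx, hx'⟩ := hhit x y hx hy hxy
      obtain ⟨ry, hry, hy'⟩ := hhit y x hy hx hxy.symm
      obtain ⟨rz, hrz, hz'⟩ := hhit z x hz hx hxz.symm
      obtain rfl := hcon _ _ hrx hry
      obtain rfl := hcon _ _ hrx hrz
      have n1 : x.support ≠ y.support := fun h => hxy (T_supp_inj e hx hy h.symm.subset)
      have n2 : x.support ≠ z.support := fun h => hxz (T_supp_inj e hx hz h.symm.subset)
      have n3 : y.support ≠ z.support := fun h => hyz (T_supp_inj e hy hz h.symm.subset)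
      grind
    refine ⟨fun r => if r = r1 then monomial x 1 - monomial y 1 else
      monomial y 1 - monomial z 1, ?_, ?_⟩
    · intro r
      dsimp only
      split_ifs
      · exact hI x hx y hy
      · exact hI y hy z hz
    set J := Ideal.span ((fun r => if r = r1 then (monomial x 1 - monomial y 1 :
      MvPolynomial (Fin m) K) else monomial y 1 - monomial z 1) ''
          {r | (dv e (p r)).support = W}) with hJ
    have b1 : (monomial x 1 - monomial y 1 : MvPolynomial (Fin m) K) ∈ J :=
      Ideal.subset_span ⟨r1, hr1, by simp⟩
    have b2 : (monomial y 1 - monomial z 1 : MvPolynomial (Fin m) K) ∈ J :=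
      Ideal.subset_span ⟨r2, hr2, by simp [hr.symm]⟩
    have b3 : (monomial x 1 - monomial z 1 : MvPolynomial (Fin m) K) ∈ J := by
      have := add_mem b1 b2
      rwa [sub_add_sub_cancel] at this
    intro u hu w hw
    rw [hT] at hu hw
    rcases hu with rfl | rfl | rfl <;> rcases hw with rfl | rfl | rfl <;>
      first
      | (rw [sub_self]; exact Ideal.zero_mem _)
      | assumption
      | (rw [← neg_sub]; apply neg_mem; assumption)

lemma gens_of_rad (he : Function.Injective e) (hl : ∀ i, ¬ (e i).IsDiag)
    (S : Set (MvPolynomial (Fin m) K))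
    (hS : ∀ p ∈ S, ∃ i j k l : Fin m, p = X i * X j - X k * X l)
    (hSI : Ideal.span S = toricIdeal K e)
    {s : ℕ} (F : Fin s → MvPolynomial (Fin m) K) (hF : ∀ i, IsBinomial (F i))
    (hFI : ∀ i, F i ∈ toricIdeal K e)
    (hrad : (Ideal.span (Set.range F)).radical = toricIdeal K e) :
    ∃ G : Fin s → MvPolynomial (Fin m) K, Ideal.span (Set.range G) = toricIdeal K e := by
  choose p q hpq using hF
  obtain rfl : F = fun r => monomial (p r) 1 - monomial (q r) 1 := funext hpq
  have hdv : ∀ r, dv e (p r) = dv e (q r) := fun r => (mem_toric (K := K) e _ _).1 (hFI r)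
  choose g hgI hg using local_gens (K := K) e he hl p q hdv hrad
  refine ⟨fun r => g (dv e (p r)).support r, le_antisymm ?_ ?_⟩
  · rw [Ideal.span_le]
    rintro _ ⟨r, rfl⟩
    exact hgI _ _
  · conv_lhs => rw [← hSI]
    rw [Ideal.span_le]
    intro f hf
    have hfI : f ∈ toricIdeal K e := hSI ▸ Ideal.subset_span hf
    obtain ⟨i, j, k, l, rfl⟩ := hS f hf
    rw [XX_eq, XX_eq] at hfI ⊢
    rw [mem_toric] at hfI
    rcases quad_cases e he hl i j k l hfI with h | ⟨W, h1, h2⟩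
    · rw [h, sub_self]; exact Ideal.zero_mem _
    · refine Ideal.span_mono ?_ (hg W _ h1 _ h2)
      rintro _ ⟨r, hr, rfl⟩
      refine ⟨r, ?_⟩
      dsimp only
      rw [show (dv e (p r)).support = W from hr]

end lower

end BarToric

/-- If the toric ideal `I_G` of a finite connected simple graph `G` is
generated by quadratic binomials, then the binomial arithmetical rank of `I_G` equals its
minimal number of generators. -/
theorem bar_toricIdeal_eq_mu_of_quadratic {K : Type*} [Field K] [IsAlgClosed K]
    {n m : ℕ} (e : Fin m → Sym2 (Fin n))
    (he : Function.Injective e) (hl : ∀ i, ¬ (e i).IsDiag)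
    (hconn : (SimpleGraph.fromEdgeSet (Set.range e)).Connected)
    (hquad : ∃ S : Set (MvPolynomial (Fin m) K),
      (∀ p ∈ S, ∃ i j k l : Fin m, p = X i * X j - X k * X l) ∧
      Ideal.span S = toricIdeal K e)
 :
    bar (toricIdeal K e) = mu (toricIdeal K e) := by
  obtain ⟨S, hS, hSI⟩ := hquad
  obtain ⟨d, ⟨F, hFb, hF⟩, hmin⟩ := BarToric.exists_min_gens S hS
  rw [hSI] at hF hmin
  have hprime : (toricIdeal K e).IsPrime := RingHom.ker_isPrime _
  have hd1 : d ∈ {s | ∃ F : Fin s → MvPolynomial (Fin m) K, (∀ i, IsBinomial (F i)) ∧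
      (∀ i, F i ∈ toricIdeal K e) ∧ (Ideal.span (Set.range F)).radical = toricIdeal K e} :=
    ⟨F, hFb, fun i => hF ▸ Ideal.subset_span ⟨i, rfl⟩, by rw [hF, hprime.radical]⟩
  have hd2 : d ∈ {s | ∃ F : Fin s → MvPolynomial (Fin m) K,
      Ideal.span (Set.range F) = toricIdeal K e} := ⟨F, hF⟩
  apply le_antisymm
  · refine (Nat.sInf_le hd1).trans ?_
    obtain ⟨G, hG⟩ := Nat.sInf_mem ⟨d, hd2⟩
    exact hmin _ G hG
  · obtain ⟨G, hGb, hGI, hG⟩ := Nat.sInf_mem ⟨d, hd1⟩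
    exact Nat.sInf_le (BarToric.gens_of_rad e he hl S hS hSI G hGb hGI hG)
end
end

section
/- Let G be a finite connected simple graph such that the toric ideal I_G is generated by quadratic binomials. Then the G-homogeneous arithmetical rank of I_G equals its minimal number of generators: ara_G(I_G) = μ(I_G). -/
open MvPolynomial

noncomputable section

/-- The `G`-degree of an exponent vector `u`: `deg_G(x^u) = u_1 a_1 + ⋯ + u_m a_m ∈ ℤ^n`. -/
def degG {n m : ℕ} (e : Fin m → Sym2 (Fin n)) (u : Fin m →₀ ℕ) : Fin n → ℤ :=
  fun j => ∑ i, (u i : ℤ) * (incid e i j : ℤ)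

/-- A polynomial is `G`-homogeneous if all monomials appearing in it have the same
`G`-degree. -/
def IsGHomogeneous {K : Type*} [CommRing K] {n m : ℕ} (e : Fin m → Sym2 (Fin n))
    (p : MvPolynomial (Fin m) K) : Prop :=
  ∀ u ∈ p.support, ∀ v ∈ p.support, degG e u = degG e v

/-- The `G`-homogeneous arithmetical rank: the least `s` such that there are `s`
`G`-homogeneous polynomials in `I` generating `I` up to radical. -/
def araG {K : Type*} [CommRing K] {n m : ℕ} (e : Fin m → Sym2 (Fin n))
    (I : Ideal (MvPolynomial (Fin m) K)) : ℕ :=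
  sInf {s | ∃ F : Fin s → MvPolynomial (Fin m) K, (∀ i, IsGHomogeneous e (F i)) ∧
    (∀ i, F i ∈ I) ∧ (Ideal.span (Set.range F)).radical = I}

/-- exponent of the image of `x i` -/
def dvec {n m : ℕ} (e : Fin m → Sym2 (Fin n)) (i : Fin m) : Fin n →₀ ℕ :=
  Finsupp.equivFunOnFinite.symm (incid e i)

lemma toricMap_X {K : Type*} [Field K] {n m : ℕ} (e : Fin m → Sym2 (Fin n)) (i : Fin m) :
    toricMap K e (X i) = monomial (dvec e i) 1 := by
  rw [toricMap, aeval_X, monomial_eq, Finsupp.prod_fintype]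
  · simp [dvec]
  · simp

lemma mem_quad {K : Type*} [Field K] {n m : ℕ} (e : Fin m → Sym2 (Fin n)) (i j k l : Fin m) :
    (X i * X j - X k * X l : MvPolynomial (Fin m) K) ∈ toricIdeal K e ↔
      ∀ v, incid e i v + incid e j v = incid e k v + incid e l v := by
  rw [toricIdeal, RingHom.mem_ker, map_sub, map_mul, map_mul, sub_eq_zero]
  simp only [toricMap_X, monomial_mul, mul_one]
  rw [monomial_left_inj one_ne_zero, Finsupp.ext_iff]
  simp [dvec]

lemma exists_other {K : Type*} [Field K] {n m : ℕ} (e : Fin m → Sym2 (Fin n))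
    (F : MvPolynomial (Fin m) K) (hF : F ∈ toricIdeal K e) (u : Fin m →₀ ℕ)
    (hu : u ∈ F.support) : ∃ u' ∈ F.support, u' ≠ u := by
  by_contra! h
  have h1 : F = monomial u (coeff u F) := by
    ext w
    rw [coeff_monomial]
    split_ifs with hw
    · rw [hw]
    · by_contra hc
      exact hw (h w (mem_support_iff.2 hc)).symm
  rw [toricIdeal, RingHom.mem_ker, h1, monomial_eq, map_mul, Finsupp.prod, map_prod] at hF
  rw [mem_support_iff] at hu
  have h2 : toricMap K e (C (coeff u F)) ≠ 0 := by
    rw [toricMap, aeval_C]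
    simpa using hu
  have h3 : ∏ i ∈ u.support, toricMap K e (X i ^ u i) ≠ 0 := by
    rw [Finset.prod_ne_zero_iff]
    intro i _
    rw [map_pow, toricMap_X]
    exact pow_ne_zero _ (by simp)
  exact (mul_ne_zero h2 h3) hF

/-- vertices occurring in the degree of `F` -/
def vsupp {K : Type*} [CommRing K] {n m : ℕ} (e : Fin m → Sym2 (Fin n))
    (F : MvPolynomial (Fin m) K) : Set (Fin n) :=
  {v | ∃ u ∈ F.support, degG e u v ≠ 0}

lemma degG_ne {n m : ℕ} (e : Fin m → Sym2 (Fin n)) (u : Fin m →₀ ℕ) (v : Fin n) :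
    degG e u v ≠ 0 ↔ ∃ i, u i ≠ 0 ∧ v ∈ e i := by
  rw [degG, Ne, Finset.sum_eq_zero_iff_of_nonneg (fun i _ => by positivity)]
  simp only [Finset.mem_univ, true_implies, not_forall]
  apply exists_congr
  intro i
  simp [incid, and_comm]

/-- three vertices: exponent determined by degree -/
lemma tri {n m : ℕ} (e : Fin m → Sym2 (Fin n)) (he : Function.Injective e)
    (hl : ∀ i, ¬ (e i).IsDiag) (x y z : Fin n) (hxy : x ≠ y) (hxz : x ≠ z) (hyz : y ≠ z)
    (u : Fin m →₀ ℕ) (hu : ∀ v, degG e u v ≠ 0 → v = x ∨ v = y ∨ v = z)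
    (i : Fin m) (hi : e i = s(x,y)) :
    (2 * (u i : ℤ)) = degG e u x + degG e u y - degG e u z := by
  simp only [degG]
  rw [← Finset.sum_add_distrib, ← Finset.sum_sub_distrib, Finset.sum_eq_single i]
  · simp [incid, hi, hxz.symm, hyz.symm]
    ring
  · intro j _ hj
    by_cases h0 : u j = 0
    · simp [h0]
    have hv : ∀ v ∈ e j, v = x ∨ v = y ∨ v = z := fun v hv => hu v ((degG_ne e u v).2 ⟨j, h0, hv⟩)
    have hne : e j ≠ s(x,y) := fun h => hj (he (h.trans hi.symm))
    have hd := hl j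
    simp only [incid]
    generalize e j = q at *
    induction q using Sym2.ind with
    | _ p r =>
    simp only [Sym2.mem_iff, Sym2.mk_isDiag_iff] at *
    have h1 := hv p (Or.inl rfl)
    have h2 := hv r (Or.inr rfl)
    rcases h1 with rfl | rfl | rfl <;> rcases h2 with rfl | rfl | rfl <;>
      simp_all [eq_comm]
  · simp

lemma no_tri {K : Type*} [Field K] {n m : ℕ} (e : Fin m → Sym2 (Fin n))
    (he : Function.Injective e)
    (hl : ∀ i, ¬ (e i).IsDiag) (x y z : Fin n) (hxy : x ≠ y) (hxz : x ≠ z) (hyz : y ≠ z)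
    (F : MvPolynomial (Fin m) K) (hF : F ∈ toricIdeal K e) (hh : IsGHomogeneous e F)
    (hD : ∀ v ∈ vsupp e F, v = x ∨ v = y ∨ v = z) : F = 0 := by
  by_contra h0
  obtain ⟨u, hu⟩ := support_nonempty.2 h0
  obtain ⟨u', hu', hne⟩ := exists_other e F hF u hu
  apply hne
  have hd : degG e u' = degG e u := hh u' hu' u hu
  have key : ∀ w ∈ F.support, ∀ v, degG e w v ≠ 0 → v = x ∨ v = y ∨ v = z :=
    fun w hw v hv => hD v ⟨w, hw, hv⟩
  ext j
  by_cases hj : ∀ v ∈ e j, v = x ∨ v = y ∨ v = z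
  · have hdj := hl j
    have main : ∀ x' y' z' : Fin n, x' ≠ y' → x' ≠ z' → y' ≠ z' →
        (∀ v, (v = x ∨ v = y ∨ v = z) → (v = x' ∨ v = y' ∨ v = z')) → e j = s(x', y') →
        u' j = u j := by
      intro x' y' z' h1 h2 h3 h4 h5
      have := tri e he hl x' y' z' h1 h2 h3 u (fun v hv => h4 v (key u hu v hv)) j h5
      have h' := tri e he hl x' y' z' h1 h2 h3 u' (fun v hv => h4 v (key u' hu' v hv)) j h5
      rw [hd] at h'
      omega
    generalize hq : e j = q at *
    induction q using Sym2.ind with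
    | _ p r =>
    simp only [Sym2.mem_iff, Sym2.mk_isDiag_iff] at *
    have h1 := hj p (Or.inl rfl)
    have h2 := hj r (Or.inr rfl)
    have : ∃ t, p ≠ t ∧ r ≠ t ∧ ∀ v, (v = x ∨ v = y ∨ v = z) → (v = p ∨ v = r ∨ v = t) := by
      rcases h1 with rfl | rfl | rfl <;> rcases h2 with rfl | rfl | rfl <;>
        first
        | exact absurd rfl hdj
        | exact ⟨x, by grind⟩
        | exact ⟨y, by grind⟩
        | exact ⟨z, by grind⟩
    obtain ⟨t, ht1, ht2, ht⟩ := this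
    exact main p r t hdj ht1 ht2 ht rfl
  · have : ∀ w ∈ F.support, w j = 0 := by
      intro w hw
      by_contra hc
      exact hj fun v hv => key w hw v ((degG_ne e w v).2 ⟨j, hc, hv⟩)
    rw [this u hu, this u' hu']

lemma eval_ne_monomial {K : Type*} [Field K] {m : ℕ}
    (F : MvPolynomial (Fin m) K) (x : Fin m → K) (hx : eval x F ≠ 0) :
    ∃ u ∈ F.support, ∀ i, u i ≠ 0 → x i ≠ 0 := by
  rw [eval_eq'] at hx
  obtain ⟨u, hu, h⟩ := Finset.exists_ne_zero_of_sum_ne_zero hx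
  refine ⟨u, hu, fun i hi hx => ?_⟩
  apply h
  rw [Finset.prod_eq_zero (Finset.mem_univ i) (by rw [hx, zero_pow hi]), mul_zero]

lemma vsupp_eq {K : Type*} [Field K] {n m : ℕ} (e : Fin m → Sym2 (Fin n))
    (he : Function.Injective e)
    (hl : ∀ i, ¬ (e i).IsDiag) (a b c d : Fin n) (hab : a ≠ b) (hac : a ≠ c) (had : a ≠ d)
    (hbc : b ≠ c) (hbd : b ≠ d) (hcd : c ≠ d)
    (F : MvPolynomial (Fin m) K) (hF : F ∈ toricIdeal K e) (hh : IsGHomogeneous e F)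
    (x : Fin m → K) (hx : ∀ i, x i ≠ 0 → ∀ v ∈ e i, v = a ∨ v = b ∨ v = c ∨ v = d)
    (hFx : eval x F ≠ 0) : vsupp e F = {a, b, c, d} := by
  obtain ⟨u, hu, hux⟩ := eval_ne_monomial F x hFx
  have hF0 : F ≠ 0 := by rintro rfl; simp at hFx
  have hsub : ∀ v ∈ vsupp e F, v = a ∨ v = b ∨ v = c ∨ v = d := by
    rintro v ⟨w, hw, hwv⟩
    rw [hh w hw u hu, degG_ne] at hwv
    obtain ⟨i, hi, hvi⟩ := hwv
    exact hx i (hux i hi) v hvi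
  have hA : a ∈ vsupp e F := by
    by_contra h
    exact hF0 (no_tri e he hl b c d hbc hbd hcd F hF hh (by grind))
  have hB : b ∈ vsupp e F := by
    by_contra h
    exact hF0 (no_tri e he hl a c d hac had hcd F hF hh (by grind))
  have hC : c ∈ vsupp e F := by
    by_contra h
    exact hF0 (no_tri e he hl a b d hab had hbd F hF hh (by grind))
  have hD : d ∈ vsupp e F := by
    by_contra h
    exact hF0 (no_tri e he hl a b c hab hac hbc F hF hh (by grind))
  ext v
  simp only [Set.mem_insert_iff, Set.mem_singleton_iff]
  exact ⟨hsub v, by rintro (rfl | rfl | rfl | rfl) <;> assumption⟩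

lemma eval_zero_of_radical {K : Type*} [Field K] {m s : ℕ} {I : Ideal (MvPolynomial (Fin m) K)}
    (F : Fin s → MvPolynomial (Fin m) K) (hr : (Ideal.span (Set.range F)).radical = I)
    (x : Fin m → K) (hx : ∀ q, eval x (F q) = 0) (p : MvPolynomial (Fin m) K) (hp : p ∈ I) :
    eval x p = 0 := by
  have h1 : Ideal.span (Set.range F) ≤ RingHom.ker (eval x) := by
    rw [Ideal.span_le]
    rintro _ ⟨q, rfl⟩
    exact hx q
  rw [← hr] at hp
  obtain ⟨N, hN⟩ := hp
  have := h1 hN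
  rw [RingHom.mem_ker, map_pow] at this
  exact eq_zero_of_pow_eq_zero this

lemma comb {α : Type*} [DecidableEq α] (a b c d p q r t : α)
   (h1 : a ≠ b) (h2 : c ≠ d) (h3 : p ≠ q) (h4 : r ≠ t)
   (h : ∀ v, (if v = a ∨ v = b then 1 else 0) + (if v = c ∨ v = d then 1 else 0) =
     (if v = p ∨ v = q then 1 else 0) + (if v = r ∨ v = t then 1 else 0))
   (hn1 : ¬ (s(a,b) = s(p,q) ∧ s(c,d) = s(r,t)))
   (hn2 : ¬ (s(a,b) = s(r,t) ∧ s(c,d) = s(p,q))) :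
   a ≠ c ∧ a ≠ d ∧ b ≠ c ∧ b ≠ d ∧
    ((s(p,q) = s(a,c) ∧ s(r,t) = s(b,d)) ∨ (s(r,t) = s(a,c) ∧ s(p,q) = s(b,d)) ∨
     (s(p,q) = s(a,d) ∧ s(r,t) = s(b,c)) ∨ (s(r,t) = s(a,d) ∧ s(p,q) = s(b,c))) := by
  have ha := h a
  have hb := h b
  have hc := h c
  have hd := h d
  have hp := h p
  have hq := h q
  have hr := h r
  have ht := h t
  clear h
  simp only [Sym2.eq_iff] at *
  have hp' : p = a ∨ p = b ∨ p = c ∨ p = d := by clear hn1 hn2; grind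
  have hq' : q = a ∨ q = b ∨ q = c ∨ q = d := by clear hn1 hn2; grind
  have hr' : r = a ∨ r = b ∨ r = c ∨ r = d := by clear hn1 hn2; grind
  have ht' : t = a ∨ t = b ∨ t = c ∨ t = d := by clear hn1 hn2; grind
  rcases hp' with rfl | rfl | rfl | rfl <;> rcases hq' with rfl | rfl | rfl | rfl <;>
    rcases hr' with rfl | rfl | rfl | rfl <;> rcases ht' with rfl | rfl | rfl | rfl <;> grind

lemma hc_mul {K : Type*} [Field K] {m : ℕ} (S : Set (MvPolynomial (Fin m) K))
    (hS : ∀ p ∈ S, p.IsHomogeneous 2) (p : MvPolynomial (Fin m) K) (hp : p ∈ Ideal.span S) :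
    ∀ r, homogeneousComponent 2 (p * r) = C (coeff 0 r) * homogeneousComponent 2 p := by
  induction hp using Submodule.span_induction with
  | mem p hp =>
    intro r
    have hp2 := hS p hp
    rw [homogeneousComponent_eq_self hp2]
    conv_lhs => rw [← sum_homogeneousComponent r, Finset.mul_sum, map_sum]
    have : ∀ i ∈ Finset.range (r.totalDegree + 1),
        homogeneousComponent 2 (p * homogeneousComponent i r) =
          if i = 0 then p * homogeneousComponent i r else 0 := by
      intro i _
      rw [homogeneousComponent_of_mem (n := 2 + i)
        (hp2.mul (homogeneousComponent_isHomogeneous i r))]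
      simp
    rw [Finset.sum_congr rfl this, Finset.sum_ite_eq']
    simp [homogeneousComponent_zero, mul_comm]
  | zero => simp
  | add x y _ _ hx hy =>
    intro r
    rw [add_mul, map_add, map_add, hx, hy, mul_add]
  | smul a x _ hx =>
    intro r
    rw [smul_eq_mul, mul_comm a x, mul_assoc, hx, hx]
    rw [← constantCoeff_eq, map_mul, constantCoeff_eq, map_mul]
    ring

lemma hom_quad {K : Type*} [Field K] {n m : ℕ} (e : Fin m → Sym2 (Fin n)) (i j k l : Fin m)
    (h : (X i * X j - X k * X l : MvPolynomial (Fin m) K) ∈ toricIdeal K e) :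
    IsGHomogeneous e (X i * X j - X k * X l : MvPolynomial (Fin m) K) := by
  rw [mem_quad] at h
  have hX : ∀ i j : Fin m, (X i * X j : MvPolynomial (Fin m) K) =
      monomial (Finsupp.single i 1 + Finsupp.single j 1) 1 := by
    intro i j
    simp [X, monomial_mul]
  have hdeg : ∀ i j : Fin m, degG e (Finsupp.single i 1 + Finsupp.single j 1) =
      fun v => ((incid e i v + incid e j v : ℕ) : ℤ) := by
    intro i j
    ext v
    simp only [degG, Finsupp.add_apply, Nat.cast_add, add_mul, Finset.sum_add_distrib]
    simp [Finsupp.single_apply]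
  have key : ∀ u ∈ (X i * X j - X k * X l : MvPolynomial (Fin m) K).support,
      degG e u = fun v => ((incid e i v + incid e j v : ℕ) : ℤ) := by
    intro u hu
    classical
    rw [hX, hX] at hu
    have := support_sub (Fin m) _ _ hu
    rw [Finset.mem_union] at this
    rcases this with h1 | h1
    · have := support_monomial_subset h1
      rw [Finset.mem_singleton] at this
      rw [this, hdeg]
    · have := support_monomial_subset h1
      rw [Finset.mem_singleton] at this
      rw [this, hdeg]
      ext v
      rw [h v]
  intro u hu v hv
  rw [key u hu, key v hv]

lemma toricIdeal_radical {K : Type*} [Field K] {n m : ℕ} (e : Fin m → Sym2 (Fin n)) :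
    (toricIdeal K e).radical = toricIdeal K e :=
  (RingHom.ker_isPrime (toricMap K e).toRingHom).radical

lemma araG_le {K : Type*} [Field K] {n m : ℕ} (e : Fin m → Sym2 (Fin n))
    (S : Set (MvPolynomial (Fin m) K))
    (hS : ∀ p ∈ S, ∃ i j k l : Fin m, p = X i * X j - X k * X l)
    (hI : Ideal.span S = toricIdeal K e) (s : ℕ) (F : Fin s → MvPolynomial (Fin m) K)
    (hF : Ideal.span (Set.range F) = toricIdeal K e) :
    ∃ s' ≤ s, ∃ F : Fin s' → MvPolynomial (Fin m) K, (∀ i, IsGHomogeneous e (F i)) ∧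
    (∀ i, F i ∈ toricIdeal K e) ∧ (Ideal.span (Set.range F)).radical = toricIdeal K e := by
  have hS2 : ∀ p ∈ S, p.IsHomogeneous 2 := by
    intro p hp
    obtain ⟨i, j, k, l, rfl⟩ := hS p hp
    exact ((isHomogeneous_X K i).mul (isHomogeneous_X K j)).sub
      ((isHomogeneous_X K k).mul (isHomogeneous_X K l))
  let W : Set (MvPolynomial (Fin m) K) := Set.range fun q => homogeneousComponent 2 (F q)
  have hL : ∀ p ∈ S, p ∈ Submodule.span K W := by
    intro p hp
    have h1 : p ∈ Ideal.span (Set.range F) := by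
      rw [hF, ← hI]; exact Ideal.subset_span hp
    obtain ⟨c, hc⟩ := (Ideal.mem_span_range_iff_exists_fun).1 h1
    rw [← homogeneousComponent_eq_self (hS2 p hp), ← hc, map_sum]
    refine Submodule.sum_mem _ fun q _ => ?_
    rw [mul_comm, hc_mul S hS2 (F q)
      (by rw [hI, ← hF]; exact Ideal.subset_span ⟨q, rfl⟩), C_mul']
    exact Submodule.smul_mem _ _ (Submodule.subset_span ⟨q, rfl⟩)
  obtain ⟨b, hbS, hbspan, hli⟩ := exists_linearIndependent K S
  have hWf : Fintype W := (Set.finite_range _).fintype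
  have hle := linearIndependent_le_span' (Subtype.val : b → _) hli W (by
    rintro _ ⟨x, rfl⟩
    exact hL x (hbS x.2))
  have hbfin : Finite b := by
    rw [← Cardinal.lt_aleph0_iff_finite]
    exact hle.trans_lt (Cardinal.natCast_lt_aleph0)
  have hcard : Nat.card b ≤ s := by
    have h1 : Nat.card b ≤ Fintype.card W := by
      rw [← Nat.cast_card] at hle
      exact_mod_cast hle
    have h2 : Fintype.card W ≤ s := by
      have := Fintype.card_range_le (fun q => homogeneousComponent 2 (F q))
      rw [Fintype.card_fin] at this
      convert this
    exact h1.trans h2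
  have hIb : Ideal.span b = toricIdeal K e := by
    rw [← hI]
    apply le_antisymm (Ideal.span_mono hbS)
    rw [Ideal.span_le]
    intro p hp
    have h1 : p ∈ Submodule.span K b := hbspan ▸ Submodule.subset_span hp
    exact Submodule.span_le_restrictScalars K (MvPolynomial (Fin m) K) b h1
  let eq := (Finite.equivFin b).symm
  have hmem : ∀ i, (eq i : MvPolynomial (Fin m) K) ∈ toricIdeal K e := fun i => by
    rw [← hI]; exact Ideal.subset_span (hbS (eq i).2)
  refine ⟨Nat.card b, hcard, fun i => (eq i : MvPolynomial (Fin m) K), ?_, hmem, ?_⟩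
  · intro q
    have hm := hmem q
    obtain ⟨i, j, k, l, h⟩ := hS _ (hbS (eq q).2)
    change IsGHomogeneous e (eq q : MvPolynomial (Fin m) K)
    rw [h] at hm ⊢
    exact hom_quad e i j k l hm
  · have : Set.range (fun i => (eq i : MvPolynomial (Fin m) K)) = b := by
      have h := eq.surjective.range_comp (Subtype.val : b → MvPolynomial (Fin m) K)
      rw [Subtype.range_coe] at h
      exact h
    rw [this, hIb, toricIdeal_radical]

lemma nv {K : Type*} [Field K] {n m : ℕ} (e : Fin m → Sym2 (Fin n))
    (he : Function.Injective e)
    (hl : ∀ i, ¬ (e i).IsDiag) (a b c d : Fin n) (hab : a ≠ b) (hac : a ≠ c) (had : a ≠ d)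
    (hbc : b ≠ c) (hbd : b ≠ d) (hcd : c ≠ d) (s : ℕ)
    (F : Fin s → MvPolynomial (Fin m) K) (hF : ∀ q, F q ∈ toricIdeal K e)
    (hh : ∀ q, IsGHomogeneous e (F q))
    (hr : (Ideal.span (Set.range F)).radical = toricIdeal K e)
    (x : Fin m → K) (hx : ∀ i, x i ≠ 0 → ∀ v ∈ e i, v = a ∨ v = b ∨ v = c ∨ v = d)
    (p : MvPolynomial (Fin m) K) (hp : p ∈ toricIdeal K e) (hpx : eval x p ≠ 0) :
    ∃ q, eval x (F q) ≠ 0 ∧ vsupp e (F q) = {a, b, c, d} := by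
  by_contra! h
  apply hpx
  refine eval_zero_of_radical F hr x (fun q => ?_) p hp
  by_contra hq
  exact h q hq (vsupp_eq e he hl a b c d hab hac had hbc hbd hcd (F q) (hF q) (hh q) x hx hq)

lemma mem_of_edges {K : Type*} [Field K] {n m : ℕ} (e : Fin m → Sym2 (Fin n))
    (a b c d : Fin n) (hab : a ≠ b) (hac : a ≠ c) (had : a ≠ d)
    (hbc : b ≠ c) (hbd : b ≠ d) (hcd : c ≠ d) (i j k l : Fin m) (hi : e i = s(a,b))
    (hj : e j = s(c,d)) (hk : e k = s(a,c)) (hl : e l = s(b,d)) :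
    (X i * X j - X k * X l : MvPolynomial (Fin m) K) ∈ toricIdeal K e := by
  rw [mem_quad]
  intro v
  simp only [incid, hi, hj, hk, hl, Sym2.mem_iff]
  by_cases h1 : v = a
  · subst h1; simp [*]
  by_cases h2 : v = b
  · subst h2; simp [*]
  by_cases h3 : v = c
  · subst h3; simp [*]
  simp [*]

/-- indicator of two coordinates -/
def ind2 (K : Type*) [Field K] {m : ℕ} (i j : Fin m) : Fin m → K :=
  fun z => if z = i ∨ z = j then 1 else 0

lemma ind2_ne {K : Type*} [Field K] {m : ℕ} (i j z : Fin m) :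
    ind2 K i j z ≠ 0 ↔ z = i ∨ z = j := by
  simp only [ind2]
  split_ifs with h <;> simp [h]

lemma nv2 {K : Type*} [Field K] {n m : ℕ} (e : Fin m → Sym2 (Fin n))
    (he : Function.Injective e)
    (hl : ∀ i, ¬ (e i).IsDiag) (a b c d : Fin n) (hab : a ≠ b) (hac : a ≠ c) (had : a ≠ d)
    (hbc : b ≠ c) (hbd : b ≠ d) (hcd : c ≠ d) (s : ℕ)
    (F : Fin s → MvPolynomial (Fin m) K) (hF : ∀ q, F q ∈ toricIdeal K e)
    (hh : ∀ q, IsGHomogeneous e (F q))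
    (hr : (Ideal.span (Set.range F)).radical = toricIdeal K e)
    (i j k l : Fin m) (hi : e i = s(a,b))
    (hj : e j = s(c,d)) (hk : e k = s(a,c)) (hl' : e l = s(b,d)) :
    ∃ q, vsupp e (F q) = {a, b, c, d} ∧ ∃ u ∈ (F q).support, ∀ z, u z ≠ 0 → z = i ∨ z = j := by
  have hki : k ≠ i := by
    rintro rfl
    rw [hk, Sym2.eq_iff] at hi
    grind
  have hkj : k ≠ j := by
    rintro rfl
    rw [hk, Sym2.eq_iff] at hj
    grind
  obtain ⟨q, hq, hv⟩ := nv e he hl a b c d hab hac had hbc hbd hcd s F hF hh hr (ind2 K i j)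
    (by
      intro z hz v hv
      rw [ind2_ne] at hz
      rcases hz with rfl | rfl
      · rw [hi, Sym2.mem_iff] at hv; tauto
      · rw [hj, Sym2.mem_iff] at hv; tauto)
    _ (mem_of_edges e a b c d hab hac had hbc hbd hcd i j k l hi hj hk hl')
    (by simp [ind2, hki, hkj])
  obtain ⟨u, hu, hu'⟩ := eval_ne_monomial _ _ hq
  exact ⟨q, hv, u, hu, fun z hz => (ind2_ne i j z).1 (hu' z hz)⟩

lemma degG_sub {n m : ℕ} (e : Fin m → Sym2 (Fin n)) (u : Fin m →₀ ℕ) (T : Finset (Fin m))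
    (h : ∀ z, u z ≠ 0 → z ∈ T) (v : Fin n) :
    degG e u v = ∑ z ∈ T, (u z : ℤ) * (incid e z v : ℤ) := by
  rw [degG]
  symm
  apply Finset.sum_subset (Finset.subset_univ _)
  intro z _ hz
  have : u z = 0 := by
    by_contra h0
    exact hz (h z h0)
  simp [this]

lemma six {K : Type*} [Field K] [IsAlgClosed K] {n m : ℕ} (e : Fin m → Sym2 (Fin n))
    (he : Function.Injective e)
    (hl : ∀ i, ¬ (e i).IsDiag) (a b c d : Fin n) (hab : a ≠ b) (hac : a ≠ c) (had : a ≠ d)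
    (hbc : b ≠ c) (hbd : b ≠ d) (hcd : c ≠ d) (s : ℕ)
    (F : Fin s → MvPolynomial (Fin m) K) (hF : ∀ q, F q ∈ toricIdeal K e)
    (hh : ∀ q, IsGHomogeneous e (F q))
    (hr : (Ideal.span (Set.range F)).radical = toricIdeal K e)
    (i j k l f g : Fin m) (hi : e i = s(a,b))
    (hj : e j = s(c,d)) (hk : e k = s(a,c)) (hl' : e l = s(b,d))
    (hf : e f = s(a,d)) (hg : e g = s(b,c)) :
    ∃ q q', q ≠ q' ∧ vsupp e (F q) = {a, b, c, d} ∧ vsupp e (F q') = {a, b, c, d} := by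
  by_contra! hcon
  obtain ⟨q, hq, u, hu, huz⟩ := nv2 e he hl a b c d hab hac had hbc hbd hcd s F hF hh hr
    i j k l hi hj hk hl'
  have huniq : ∀ q', vsupp e (F q') = {a, b, c, d} → q' = q := by
    intro q' hq'
    by_contra hne
    exact hcon q q' (Ne.symm hne) hq hq'
  obtain ⟨q', hq', w, hw, hwz⟩ := nv2 e he hl a d b c had hab hac hbd.symm hcd.symm hbc
    s F hF hh hr f g i j hf hg hi (by rw [hj, Sym2.eq_swap])
  have hq'' : vsupp e (F q') = {a, b, c, d} := by
    rw [hq']; ext v; simp; tauto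
  obtain rfl := huniq q' hq''
  have dist : ∀ {z z' : Fin m} {p r p' r' : Fin n}, e z = s(p, r) → e z' = s(p', r') →
      s(p, r) ≠ s(p', r') → z ≠ z' := by
    intro z z' p r p' r' h1 h2 h3 h4
    rw [h4] at h1
    exact h3 (h1.symm.trans h2)
  have hij : i ≠ j := dist hi hj (by rw [Ne, Sym2.eq_iff]; grind)
  have hik : i ≠ k := dist hi hk (by rw [Ne, Sym2.eq_iff]; grind)
  have hil : i ≠ l := dist hi hl' (by rw [Ne, Sym2.eq_iff]; grind)
  have hjk : j ≠ k := dist hj hk (by rw [Ne, Sym2.eq_iff]; grind)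
  have hjl : j ≠ l := dist hj hl' (by rw [Ne, Sym2.eq_iff]; grind)
  have hkl : k ≠ l := dist hk hl' (by rw [Ne, Sym2.eq_iff]; grind)
  have hfg : f ≠ g := dist hf hg (by rw [Ne, Sym2.eq_iff]; grind)
  have hif : f ≠ i := dist hf hi (by rw [Ne, Sym2.eq_iff]; grind)
  have hjf : f ≠ j := dist hf hj (by rw [Ne, Sym2.eq_iff]; grind)
  have hkf : f ≠ k := dist hf hk (by rw [Ne, Sym2.eq_iff]; grind)
  have hlf : f ≠ l := dist hf hl' (by rw [Ne, Sym2.eq_iff]; grind)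
  have du := degG_sub e u {i, j} (by simpa using huz)
  have dw := degG_sub e w {f, g} (by simpa using hwz)
  rw [hh q' w hw u hu] at dw
  have hua := du a
  have hub := du b
  have huc := du c
  have hud := du d
  have hwa := dw a
  have hwb := dw b
  have hwc := dw c
  have hwd := dw d
  simp [hij, hfg, incid, hi, hj, hf, hg, hab, hac, had, hbc, hbd, hcd,
    hab.symm, hac.symm, had.symm, hbc.symm, hbd.symm, hcd.symm] at hua hub huc hud hwa hwb hwc hwd
  have huij : u i = u j := by omega
  have hpos : u i ≠ 0 := by
    have : a ∈ vsupp e (F q') := by rw [hq]; simp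
    obtain ⟨t, ht, hta⟩ := this
    rw [hh q' t ht u hu] at hta
    omega
  -- the one parameter family of points
  let pt : Fin m → Polynomial K :=
    fun z => if z = i then Polynomial.X else if z = j ∨ z = k ∨ z = l then 1 else 0
  let G : Polynomial K := aeval pt (F q')
  have hG : G = ∑ t ∈ (F q').support, Polynomial.C (coeff t (F q')) * ∏ z, pt z ^ t z := by
    simp only [G, aeval_def, eval₂_eq']
    rfl
  have hcoeff : G.coeff (u i) = coeff u (F q') := by
    rw [hG, Polynomial.finsetSum_coeff]
    have hprod : ∀ t : Fin m →₀ ℕ, (∀ z, t z ≠ 0 → z ∈ ({i, j, k, l} : Finset (Fin m))) →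
        ∏ z, pt z ^ t z = Polynomial.X ^ t i := by
      intro t ht
      rw [Finset.prod_eq_single i]
      · simp [pt]
      · intro z _ hz
        by_cases h0 : t z = 0
        · simp [h0]
        · have := ht z h0
          simp only [Finset.mem_insert, Finset.mem_singleton, hz, false_or] at this
          simp [pt, hz, this]
      · simp
    rw [Finset.sum_eq_single u]
    · rw [hprod u (fun z hz => by have := huz z hz; simp; tauto)]
      simp
    · intro t ht htu
      by_cases hts : ∀ z, t z ≠ 0 → z ∈ ({i, j, k, l} : Finset (Fin m))
      · rw [hprod t hts, Polynomial.coeff_C_mul, Polynomial.coeff_X_pow]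
        rw [if_neg, mul_zero]
        intro heq
        apply htu
        have dt := degG_sub e t _ hts
        rw [hh q' t ht u hu] at dt
        have hta := dt a
        have htb := dt b
        have htc := dt c
        simp [hij, hik, hil, hjk, hjl, hkl, incid, hi, hj, hk, hl', hab, hac, had, hbc, hbd, hcd,
          hab.symm, hac.symm, had.symm, hbc.symm, hbd.symm, hcd.symm] at hta htb htc
        have e1 : t k = 0 := by omega
        have e2 : t l = 0 := by omega
        have e3 : t j = u j := by omega
        ext z
        by_cases z1 : z = i
        · rw [z1, heq]
        by_cases z2 : z = j
        · rw [z2, e3]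
        have z3 : u z = 0 := by
          by_contra h0
          rcases huz z h0 with h | h <;> contradiction
        rw [z3]
        by_contra h0
        have := hts z h0
        simp only [Finset.mem_insert, Finset.mem_singleton, z1, z2, false_or] at this
        rcases this with rfl | rfl <;> contradiction
      · push Not at hts
        obtain ⟨z, hz, hz'⟩ := hts
        simp only [Finset.mem_insert, Finset.mem_singleton, not_or] at hz'
        rw [Finset.prod_eq_zero (Finset.mem_univ z)]
        · simp
        · simp [pt, hz', hz]
    · intro h
      exact absurd hu h
  have hdeg : G.degree ≠ 0 := by
    intro h
    have h1 := Polynomial.natDegree_eq_of_degree_eq_some h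
    have h2 : G.coeff (u i) = 0 := Polynomial.coeff_eq_zero_of_natDegree_lt (by
      rw [h1]; exact Nat.pos_of_ne_zero hpos)
    rw [hcoeff] at h2
    exact (mem_support_iff.1 hu) h2
  obtain ⟨t, ht⟩ := IsAlgClosed.exists_root G hdeg
  let x : Fin m → K := fun z => (pt z).eval t
  have hxev : ∀ P : MvPolynomial (Fin m) K, eval x P = (aeval pt P).eval t := by
    intro P
    induction P using MvPolynomial.induction_on with
    | C r => simp
    | add p r hp hr => simp [hp, hr]
    | mul_X p z hp => simp [hp, x]
  have hmem : (X k * X l - X f * X g : MvPolynomial (Fin m) K) ∈ toricIdeal K e :=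
    mem_of_edges e a c d b hac had hab hcd hbc.symm hbd.symm k l f g hk
      (by rw [hl', Sym2.eq_swap]) hf (by rw [hg, Sym2.eq_swap])
  obtain ⟨q2, hq2, hv2⟩ := nv e he hl a b c d hab hac had hbc hbd hcd s F hF hh hr x
    (by
      intro z hz v hv
      have : z = i ∨ z = j ∨ z = k ∨ z = l := by
        by_contra hn
        apply hz
        push Not at hn
        simp [x, pt, hn]
      rcases this with rfl | rfl | rfl | rfl
      · rw [hi, Sym2.mem_iff] at hv; tauto
      · rw [hj, Sym2.mem_iff] at hv; tauto
      · rw [hk, Sym2.mem_iff] at hv; tauto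
      · rw [hl', Sym2.mem_iff] at hv; tauto)
    _ hmem
    (by simp [x, pt, hik.symm, hil.symm, hif, hjf, hkf, hlf])
  obtain rfl := huniq q2 hv2
  apply hq2
  rw [hxev]
  exact ht

lemma quad_struct {K : Type*} [Field K] {n m : ℕ} (e : Fin m → Sym2 (Fin n))
    (he : Function.Injective e)
    (hl : ∀ i, ¬ (e i).IsDiag) (i j k l : Fin m)
    (hp : (X i * X j - X k * X l : MvPolynomial (Fin m) K) ∈ toricIdeal K e)
    (h0 : (X i * X j - X k * X l : MvPolynomial (Fin m) K) ≠ 0) :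
    ∃ a b c d : Fin n, a ≠ b ∧ a ≠ c ∧ a ≠ d ∧ b ≠ c ∧ b ≠ d ∧ c ≠ d ∧
      e i = s(a,b) ∧ e j = s(c,d) ∧
      ((e k = s(a,c) ∧ e l = s(b,d)) ∨ (e l = s(a,c) ∧ e k = s(b,d))) := by
  rw [mem_quad] at hp
  have hn1 : ¬ (e i = e k ∧ e j = e l) := by
    rintro ⟨h1, h2⟩
    apply h0
    rw [he h1, he h2, sub_self]
  have hn2 : ¬ (e i = e l ∧ e j = e k) := by
    rintro ⟨h1, h2⟩
    apply h0
    rw [he h1, he h2]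
    ring
  have hdi := hl i
  have hdj := hl j
  have hdk := hl k
  have hdl := hl l
  simp only [incid] at hp
  generalize e i = ei at *
  generalize e j = ej at *
  generalize e k = ek at *
  generalize e l = el at *
  induction ei using Sym2.ind with
  | _ a b =>
  induction ej using Sym2.ind with
  | _ c d =>
  induction ek using Sym2.ind with
  | _ p q =>
  induction el using Sym2.ind with
  | _ r t =>
  simp only [Sym2.mem_iff, Sym2.mk_isDiag_iff] at hp hdi hdj hdk hdl
  obtain ⟨g1, g2, g3, g4, h⟩ := comb a b c d p q r t hdi hdj hdk hdl hp hn1 hn2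
  rcases h with h | h | h | h
  · exact ⟨a, b, c, d, hdi, g1, g2, g3, g4, hdj, rfl, rfl, Or.inl h⟩
  · exact ⟨a, b, c, d, hdi, g1, g2, g3, g4, hdj, rfl, rfl, Or.inr h⟩
  · exact ⟨a, b, d, c, hdi, g2, g1, g4, g3, (Ne.symm hdj), rfl, Sym2.eq_swap, Or.inl h⟩
  · exact ⟨a, b, d, c, hdi, g2, g1, g4, g3, (Ne.symm hdj), rfl, Sym2.eq_swap, Or.inr h⟩

lemma matching {α : Type*} (a b c d p q r t : α)
    (hpq : p ≠ q) (hpr : p ≠ r) (hpt : p ≠ t) (hqr : q ≠ r) (hqt : q ≠ t) (hrt : r ≠ t)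
    (hp : p = a ∨ p = b ∨ p = c ∨ p = d) (hq : q = a ∨ q = b ∨ q = c ∨ q = d)
    (hr : r = a ∨ r = b ∨ r = c ∨ r = d) (ht : t = a ∨ t = b ∨ t = c ∨ t = d) :
    (s(p,q) = s(a,b) ∧ s(r,t) = s(c,d)) ∨ (s(r,t) = s(a,b) ∧ s(p,q) = s(c,d)) ∨
    (s(p,q) = s(a,c) ∧ s(r,t) = s(b,d)) ∨ (s(r,t) = s(a,c) ∧ s(p,q) = s(b,d)) ∨
    (s(p,q) = s(a,d) ∧ s(r,t) = s(b,c)) ∨ (s(r,t) = s(a,d) ∧ s(p,q) = s(b,c)) := by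
  simp only [Sym2.eq_iff]
  rcases hp with rfl | rfl | rfl | rfl <;> rcases hq with rfl | rfl | rfl | rfl <;>
    first
    | exact absurd rfl hpq
    | (rcases hr with rfl | rfl | rfl | rfl <;>
        first
        | exact absurd rfl hpr
        | exact absurd rfl hqr
        | (rcases ht with rfl | rfl | rfl | rfl <;>
            first
            | exact absurd rfl hpt
            | exact absurd rfl hqt
            | exact absurd rfl hrt
            | simp))

lemma gens {K : Type*} [Field K] [IsAlgClosed K] {n m : ℕ} (e : Fin m → Sym2 (Fin n))
    (he : Function.Injective e)
    (hl : ∀ i, ¬ (e i).IsDiag) (s : ℕ)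
    (F : Fin s → MvPolynomial (Fin m) K) (hF : ∀ q, F q ∈ toricIdeal K e)
    (hh : ∀ q, IsGHomogeneous e (F q))
    (hr : (Ideal.span (Set.range F)).radical = toricIdeal K e) (D : Set (Fin n)) :
    ∃ Q : Fin s → MvPolynomial (Fin m) K, (∀ q, Q q ∈ toricIdeal K e) ∧
      ∀ i j k l : Fin m, (X i * X j - X k * X l : MvPolynomial (Fin m) K) ∈ toricIdeal K e →
        (X i * X j - X k * X l : MvPolynomial (Fin m) K) ≠ 0 →
        {v | v ∈ e i ∨ v ∈ e j} = D →
        (X i * X j - X k * X l : MvPolynomial (Fin m) K) ∈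
          Ideal.span (Q '' {q | vsupp e (F q) = D}) := by
  by_cases hex : ∃ i j k l : Fin m,
    (X i * X j - X k * X l : MvPolynomial (Fin m) K) ∈ toricIdeal K e ∧
        (X i * X j - X k * X l : MvPolynomial (Fin m) K) ≠ 0 ∧
        {v | v ∈ e i ∨ v ∈ e j} = D
  swap
  · refine ⟨fun _ => 0, fun _ => zero_mem _, fun i j k l h1 h2 h3 => ?_⟩
    exact absurd ⟨i, j, k, l, h1, h2, h3⟩ hex
  have hex' : ∃ i j k l : Fin m, ∃ a b c d : Fin n,
      a ≠ b ∧ a ≠ c ∧ a ≠ d ∧ b ≠ c ∧ b ≠ d ∧ c ≠ d ∧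
      e i = s(a,b) ∧ e j = s(c,d) ∧ e k = s(a,c) ∧ e l = s(b,d) ∧ D = {a, b, c, d} := by
    obtain ⟨i, j, k, l, h1, h2, h3⟩ := hex
    obtain ⟨a, b, c, d, g1, g2, g3, g4, g5, g6, hi, hj, h⟩ := quad_struct e he hl i j k l h1 h2
    have hD : D = {a, b, c, d} := by
      rw [← h3, hi, hj]
      ext v
      simp
      tauto
    rcases h with h | h
    · exact ⟨i, j, k, l, a, b, c, d, g1, g2, g3, g4, g5, g6, hi, hj, h.1, h.2, hD⟩
    · exact ⟨i, j, l, k, a, b, c, d, g1, g2, g3, g4, g5, g6, hi, hj, h.1, h.2, hD⟩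
  clear hex
  obtain ⟨i, j, k, l, a, b, c, d, hab, hac, had, hbc, hbd, hcd, hi, hj, hk, hl', hD⟩ := hex'
  have hM : ∀ (i' j' : Fin m) (a' b' c' d' : Fin n), a' ≠ b' → a' ≠ c' → a' ≠ d' → b' ≠ c' →
      b' ≠ d' → c' ≠ d' → e i' = s(a',b') → e j' = s(c',d') →
      (∀ v, v = a' ∨ v = b' ∨ v = c' ∨ v = d' → v ∈ D) →
      ((X i' * X j' : MvPolynomial (Fin m) K) = X i * X j ∨
       (X i' * X j' : MvPolynomial (Fin m) K) = X k * X l ∨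
       ∃ f g, e f = s(a,d) ∧ e g = s(b,c) ∧
        (X i' * X j' : MvPolynomial (Fin m) K) = X f * X g) := by
    intro i' j' a' b' c' d' h1 h2 h3 h4 h5 h6 hi' hj' hv
    subst hD
    simp only [Set.mem_insert_iff, Set.mem_singleton_iff] at hv
    have := matching a b c d a' b' c' d' h1 h2 h3 h4 h5 h6 (hv _ (by simp)) (hv _ (by simp))
      (hv _ (by simp)) (hv _ (by simp))
    rw [← hi', ← hj'] at this
    rcases this with h | h | h | h | h | h
    · left
      rw [he (h.1.trans hi.symm), he (h.2.trans hj.symm)]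
    · left
      rw [he (h.1.trans hi.symm), he (h.2.trans hj.symm), mul_comm]
    · right; left
      rw [he (h.1.trans hk.symm), he (h.2.trans hl'.symm)]
    · right; left
      rw [he (h.1.trans hk.symm), he (h.2.trans hl'.symm), mul_comm]
    · right; right
      exact ⟨i', j', h.1, h.2, rfl⟩
    · right; right
      exact ⟨j', i', h.1, h.2, mul_comm _ _⟩
  have hM2 : ∀ i' j' k' l' : Fin m,
      (X i' * X j' - X k' * X l' : MvPolynomial (Fin m) K) ∈ toricIdeal K e →
      (X i' * X j' - X k' * X l' : MvPolynomial (Fin m) K) ≠ 0 →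
      {v | v ∈ e i' ∨ v ∈ e j'} = D →
      ((X i' * X j' : MvPolynomial (Fin m) K) = X i * X j ∨
       (X i' * X j' : MvPolynomial (Fin m) K) = X k * X l ∨
       ∃ f g, e f = s(a,d) ∧ e g = s(b,c) ∧
        (X i' * X j' : MvPolynomial (Fin m) K) = X f * X g) ∧
      ((X k' * X l' : MvPolynomial (Fin m) K) = X i * X j ∨
       (X k' * X l' : MvPolynomial (Fin m) K) = X k * X l ∨
       ∃ f g, e f = s(a,d) ∧ e g = s(b,c) ∧
        (X k' * X l' : MvPolynomial (Fin m) K) = X f * X g) := by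
    intro i' j' k' l' h1 h2 h3
    obtain ⟨a', b', c', d', g1, g2, g3, g4, g5, g6, hi', hj', h⟩ :=
      quad_struct e he hl i' j' k' l' h1 h2
    have hv : ∀ v, v = a' ∨ v = b' ∨ v = c' ∨ v = d' → v ∈ D := by
      intro v hv
      rw [← h3, Set.mem_ofPred_eq, hi', hj']
      simp only [Sym2.mem_iff]
      tauto
    refine ⟨hM i' j' a' b' c' d' g1 g2 g3 g4 g5 g6 hi' hj' hv, ?_⟩
    rcases h with h | h
    · exact hM k' l' a' c' b' d' g2 g1 g3 g4.symm g6 g5 h.1 h.2 (fun v hv' => hv v (by tauto))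
    · rw [mul_comm]
      exact hM l' k' a' c' b' d' g2 g1 g3 g4.symm g6 g5 h.1 h.2 (fun v hv' => hv v (by tauto))
  have hmem1 : (X i * X j - X k * X l : MvPolynomial (Fin m) K) ∈ toricIdeal K e :=
    mem_of_edges e a b c d hab hac had hbc hbd hcd i j k l hi hj hk hl'
  by_cases hfg : ∃ f g, e f = s(a,d) ∧ e g = s(b,c)
  · obtain ⟨f, g, hf, hg⟩ := hfg
    obtain ⟨q, q', hne, hq, hq'⟩ := six e he hl a b c d hab hac had hbc hbd hcd s F hF hh hr
      i j k l f g hi hj hk hl' hf hg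
    have hmem2 : (X k * X l - X f * X g : MvPolynomial (Fin m) K) ∈ toricIdeal K e :=
      mem_of_edges e a c d b hac had hab hcd hbc.symm hbd.symm k l f g hk
        (by rw [hl', Sym2.eq_swap]) hf (by rw [hg, Sym2.eq_swap])
    let Q : Fin s → MvPolynomial (Fin m) K :=
      fun z => if z = q then X i * X j - X k * X l else X k * X l - X f * X g
    refine ⟨Q, ?_, ?_⟩
    · intro z
      simp only [Q]
      split_ifs
      · exact hmem1
      · exact hmem2
    · intro i' j' k' l' h1 h2 h3
      have s1 : (X i * X j - X k * X l : MvPolynomial (Fin m) K) ∈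
          Ideal.span (Q '' {q | vsupp e (F q) = D}) :=
        Ideal.subset_span ⟨q, by rw [Set.mem_ofPred_eq, hq, hD], by simp [Q]⟩
      have s2 : (X k * X l - X f * X g : MvPolynomial (Fin m) K) ∈
          Ideal.span (Q '' {q | vsupp e (F q) = D}) :=
        Ideal.subset_span ⟨q', by rw [Set.mem_ofPred_eq, hq', hD], by simp [Q, hne.symm]⟩
      have s3 := Ideal.add_mem _ s1 s2
      rw [sub_add_sub_cancel] at s3
      have hw : ∀ P : MvPolynomial (Fin m) K,
          (P = X i * X j ∨ P = X k * X l ∨ ∃ f g, e f = s(a,d) ∧ e g = s(b,c) ∧ P = X f * X g) →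
          P - X f * X g ∈ Ideal.span (Q '' {q | vsupp e (F q) = D}) := by
        rintro P (rfl | rfl | ⟨f', g', hf', hg', rfl⟩)
        · exact s3
        · exact s2
        · rw [he (hf'.trans hf.symm), he (hg'.trans hg.symm), sub_self]
          exact zero_mem _
      obtain ⟨m1, m2⟩ := hM2 i' j' k' l' h1 h2 h3
      have := Ideal.sub_mem _ (hw _ m1) (hw _ m2)
      rwa [sub_sub_sub_cancel_right] at this
  · obtain ⟨q, hq, -⟩ := nv2 e he hl a b c d hab hac had hbc hbd hcd s F hF hh hr
      i j k l hi hj hk hl'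
    refine ⟨fun _ => X i * X j - X k * X l, fun _ => hmem1, ?_⟩
    intro i' j' k' l' h1 h2 h3
    have s1 : (X i * X j - X k * X l : MvPolynomial (Fin m) K) ∈
        Ideal.span ((fun _ : Fin s => (X i * X j - X k * X l : MvPolynomial (Fin m) K)) ''
          {q | vsupp e (F q) = D}) :=
      Ideal.subset_span ⟨q, by rw [Set.mem_ofPred_eq, hq, hD], rfl⟩
    have hw : ∀ P : MvPolynomial (Fin m) K,
        (P = X i * X j ∨ P = X k * X l ∨ ∃ f g, e f = s(a,d) ∧ e g = s(b,c) ∧ P = X f * X g) →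
        P - X k * X l ∈ Ideal.span
          ((fun _ : Fin s => (X i * X j - X k * X l : MvPolynomial (Fin m) K)) ''
          {q | vsupp e (F q) = D}) := by
      rintro P (rfl | rfl | ⟨f', g', hf', hg', rfl⟩)
      · exact s1
      · rw [sub_self]
        exact zero_mem _
      · exact absurd ⟨f', g', hf', hg'⟩ hfg
    obtain ⟨m1, m2⟩ := hM2 i' j' k' l' h1 h2 h3
    have := Ideal.sub_mem _ (hw _ m1) (hw _ m2)
    rwa [sub_sub_sub_cancel_right] at this

lemma mu_le_of {K : Type*} [Field K] [IsAlgClosed K] {n m : ℕ} (e : Fin m → Sym2 (Fin n))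
    (he : Function.Injective e)
    (hl : ∀ i, ¬ (e i).IsDiag)
    (S : Set (MvPolynomial (Fin m) K))
    (hS : ∀ p ∈ S, ∃ i j k l : Fin m, p = X i * X j - X k * X l)
    (hI : Ideal.span S = toricIdeal K e) (s : ℕ)
    (F : Fin s → MvPolynomial (Fin m) K) (hF : ∀ q, F q ∈ toricIdeal K e)
    (hh : ∀ q, IsGHomogeneous e (F q))
    (hr : (Ideal.span (Set.range F)).radical = toricIdeal K e) :
    mu (toricIdeal K e) ≤ s := by
  choose Q hQ1 hQ2 using gens e he hl s F hF hh hr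
  apply Nat.sInf_le
  refine ⟨fun q => Q (vsupp e (F q)) q, le_antisymm ?_ ?_⟩
  · rw [Ideal.span_le]
    rintro _ ⟨q, rfl⟩
    exact hQ1 _ q
  · rw [← hI, Ideal.span_le]
    intro p hp
    have hpI : p ∈ toricIdeal K e := by rw [← hI]; exact Ideal.subset_span hp
    obtain ⟨i, j, k, l, rfl⟩ := hS p hp
    by_cases h0 : (X i * X j - X k * X l : MvPolynomial (Fin m) K) = 0
    · rw [h0]; exact zero_mem _
    · refine Ideal.span_mono ?_ (hQ2 _ i j k l hpI h0 rfl)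
      rintro _ ⟨q, hq, rfl⟩
      refine ⟨q, ?_⟩
      rw [Set.mem_ofPred_eq] at hq
      simp only [hq]

/-- If the toric ideal `I_G` of a finite connected simple graph `G` is
generated by quadratic binomials, then the `G`-homogeneous arithmetical rank of `I_G`
equals its minimal number of generators. -/
theorem araG_toricIdeal_eq_mu_of_quadratic {K : Type*} [Field K] [IsAlgClosed K]
    {n m : ℕ} (e : Fin m → Sym2 (Fin n))
    (he : Function.Injective e) (hl : ∀ i, ¬ (e i).IsDiag)
    (hconn : (SimpleGraph.fromEdgeSet (Set.range e)).Connected)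
    (hquad : ∃ S : Set (MvPolynomial (Fin m) K),
      (∀ p ∈ S, ∃ i j k l : Fin m, p = X i * X j - X k * X l) ∧
      Ideal.span S = toricIdeal K e)
 :
    araG e (toricIdeal K e) = mu (toricIdeal K e) := by
  obtain ⟨S, hS, hI⟩ := hquad
  have hne : {s | ∃ F : Fin s → MvPolynomial (Fin m) K,
      Ideal.span (Set.range F) = toricIdeal K e}.Nonempty := by
    obtain ⟨s, F, hF⟩ := Submodule.fg_iff_exists_fin_generating_family.1
      (IsNoetherian.noetherian (toricIdeal K e))
    exact ⟨s, F, hF⟩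
  obtain ⟨F, hF⟩ := Nat.sInf_mem hne
  obtain ⟨s', hs', hmem⟩ := araG_le e S hS hI _ F hF
  apply le_antisymm
  · exact (Nat.sInf_le hmem).trans hs'
  · have hne' : {s | ∃ F : Fin s → MvPolynomial (Fin m) K, (∀ i, IsGHomogeneous e (F i)) ∧
        (∀ i, F i ∈ toricIdeal K e) ∧
        (Ideal.span (Set.range F)).radical = toricIdeal K e}.Nonempty := ⟨s', hmem⟩
    obtain ⟨F', h1, h2, h3⟩ := Nat.sInf_mem hne'
    exact mu_le_of e he hl S hS hI _ F' h2 h1 h3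
end
end
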